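/- There is a universal constant c > 0 such that for every n ≥ 2 there exists an origin-symmetric ellipsoid E ⊂ R^n of volume c n^2 that contains no point of the integer lattice Z^n other than the origin. -/

import Mathlib

/- STATEMENT 2: There is a universal constant c > 0 such that for every n ≥ 2 there exists
an origin-symmetric ellipsoid E ⊂ R^n of volume c n^2 that contains no point of the integer
lattice Z^n other than the origin. An origin-symmetric ellipsoid is the image of the open
Euclidean unit ball under an invertible linear map. -/

open MeasureTheory
noncomputable section

abbrev Euc (n : ℕ) := EuclideanSpace ℝ (Fin n)

/-- The integer lattice points `ℤ^n ⊂ ℝ^n`. -/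
def intPoints (n : ℕ) : Set (Euc n) := {x | ∀ i, ∃ m : ℤ, x i = (m : ℝ)}

/-! ### The standard Gaussian distribution function -/

/-- The standard Gaussian density. -/
def gaussDensity (u : ℝ) : ℝ := (√(2 * Real.pi))⁻¹ * Real.exp (-u ^ 2 / 2)

/-- The standard Gaussian distribution function. -/
def gaussCdf (u : ℝ) : ℝ := (ProbabilityTheory.gaussianReal 0 1).real (Set.Iic u)

lemma gaussDensity_eq : gaussDensity = ProbabilityTheory.gaussianPDFReal 0 1 := by
  ext u
  simp [gaussDensity, ProbabilityTheory.gaussianPDFReal_def]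

lemma gaussCdf_eq_integral (u : ℝ) : gaussCdf u = ∫ t in Set.Iic u, gaussDensity t := by
  rw [gaussCdf, Measure.real, ProbabilityTheory.gaussianReal_apply_eq_integral 0 one_ne_zero,
    ENNReal.toReal_ofReal, gaussDensity_eq]
  exact setIntegral_nonneg measurableSet_Iic fun x _ =>
    ProbabilityTheory.gaussianPDFReal_nonneg 0 1 x

lemma continuous_gaussDensity : Continuous gaussDensity := by
  unfold gaussDensity
  fun_prop

lemma integrable_gaussDensity : Integrable gaussDensity := by
  rw [gaussDensity_eq]
  exact ProbabilityTheory.integrable_gaussianPDFReal 0 1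

lemma hasDerivAt_gaussDensity (u : ℝ) :
    HasDerivAt gaussDensity (-u * gaussDensity u) u := by
  have h : HasDerivAt (fun u : ℝ => -u ^ 2 / 2) (-u) u := by
    have := ((hasDerivAt_id u).pow 2).neg.div_const 2
    refine this.congr_deriv ?_
    norm_num
    ring
  have := h.exp.const_mul (√(2 * Real.pi))⁻¹
  refine this.congr_deriv ?_
  rw [gaussDensity]
  ring

lemma hasDerivAt_gaussCdf (u : ℝ) : HasDerivAt gaussCdf (gaussDensity u) u := by
  have h : gaussCdf = fun v => (∫ t in Set.Iic u, gaussDensity t) + ∫ t in u..v, gaussDensity t := by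
    ext v
    rw [gaussCdf_eq_integral, ← intervalIntegral.integral_Iic_sub_Iic
      integrable_gaussDensity.integrableOn integrable_gaussDensity.integrableOn]
    ring
  rw [h]
  exact (intervalIntegral.integral_hasDerivAt_right
    integrable_gaussDensity.intervalIntegrable
    continuous_gaussDensity.aestronglyMeasurable.stronglyMeasurableAtFilter
    continuous_gaussDensity.continuousAt).const_add _

lemma gaussCdf_nonneg (u : ℝ) : 0 ≤ gaussCdf u := measureReal_nonneg

lemma monotone_gaussCdf : Monotone gaussCdf := fun _ _ h =>
  measureReal_mono (Set.Iic_subset_Iic.2 h)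

lemma half_le_gaussCdf {u : ℝ} (hu : 0 ≤ u) : 1 / 2 ≤ gaussCdf u := by
  refine le_trans ?_ (monotone_gaussCdf hu)
  have h1 : (ProbabilityTheory.gaussianReal 0 1).real (Set.Ici 0) = gaussCdf 0 := by
    have h := ProbabilityTheory.gaussianReal_map_neg (μ := 0) (v := 1)
    rw [neg_zero] at h
    rw [gaussCdf]
    nth_rw 2 [← h]
    rw [map_measureReal_apply measurable_neg measurableSet_Iic]
    simp
  have h2 := measureReal_union_le (μ := ProbabilityTheory.gaussianReal 0 1)
    (Set.Iic (0 : ℝ)) (Set.Ici 0)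
  rw [Set.Iic_union_Ici, probReal_univ, h1, ← gaussCdf] at h2
  linarith

/-! ### The barrier function -/

/-- The Gaussian threshold for a geometric Brownian motion started at `y` to be at most `1`
at time `s`. -/
def hitThreshold (y s : ℝ) : ℝ := (-Real.log y + s / 2) / √s

/-- A Black-Scholes type solution of the equation `∂ₛ f = y² ∂²f / 2`. -/
def barrier (y s : ℝ) : ℝ :=
  2 * ((-Real.log y + s / 2 - 1) * gaussCdf (hitThreshold y s)
    + √s * gaussDensity (hitThreshold y s) + y * gaussCdf (hitThreshold y s - √s))

lemma mul_gaussDensity_hitThreshold {y s : ℝ} (hy : 0 < y) (hs : 0 < s) :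
    y * gaussDensity (hitThreshold y s - √s) = gaussDensity (hitThreshold y s) := by
  have h : -(hitThreshold y s - √s) ^ 2 / 2 = -hitThreshold y s ^ 2 / 2 + -Real.log y := by
    have hs' : √s ≠ 0 := (Real.sqrt_pos.2 hs).ne'
    have h1 : hitThreshold y s * √s = -Real.log y + s / 2 := by
      rw [hitThreshold]; field_simp
    have h2 : √s ^ 2 = s := Real.sq_sqrt hs.le
    linear_combination h1 - h2 / 2
  rw [gaussDensity, gaussDensity, h, Real.exp_add, Real.exp_neg, Real.exp_log hy]
  field_simp

lemma hasDerivAt_hitThreshold_left {y s : ℝ} (hy : 0 < y) :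
    HasDerivAt (fun y => hitThreshold y s) (-y⁻¹ / √s) y :=
  (((Real.hasDerivAt_log hy.ne').neg).add_const (s / 2)).div_const _

lemma hasDerivAt_barrier_left {y s : ℝ} (hy : 0 < y) (hs : 0 < s) :
    HasDerivAt (fun y => barrier y s)
      (2 * (-(gaussCdf (hitThreshold y s) / y) + gaussCdf (hitThreshold y s - √s))) y := by
  have hs' : √s ≠ 0 := (Real.sqrt_pos.2 hs).ne'
  have h1 : hitThreshold y s * √s = -Real.log y + s / 2 := by
    rw [hitThreshold]; field_simp
  have ht := hasDerivAt_hitThreshold_left (s := s) hy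
  have hΦ := (hasDerivAt_gaussCdf (hitThreshold y s)).comp y ht
  have hφ := (hasDerivAt_gaussDensity (hitThreshold y s)).comp y ht
  have hΦ' := (hasDerivAt_gaussCdf (hitThreshold y s - √s)).comp y (ht.sub_const (√s))
  have hl := (((Real.hasDerivAt_log hy.ne').neg).add_const (s / 2)).sub_const 1
  have := (((hl.mul hΦ).add (hφ.const_mul (√s))).add ((hasDerivAt_id y).mul hΦ')).const_mul 2
  refine this.congr_deriv ?_
  have hm := mul_gaussDensity_hitThreshold hy hs
  simp only [Function.comp, id, Pi.neg_apply]
  rw [← h1]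
  generalize gaussCdf (hitThreshold y s) = a at *
  generalize gaussCdf (hitThreshold y s - √s) = b at *
  generalize gaussDensity (hitThreshold y s - √s) = c at *
  rw [← hm]
  generalize hitThreshold y s = d at *
  field_simp
  ring

lemma hasDerivAt_barrier_left_deriv {y s : ℝ} (hy : 0 < y) (hs : 0 < s) :
    HasDerivAt (fun y => 2 * (-(gaussCdf (hitThreshold y s) / y)
        + gaussCdf (hitThreshold y s - √s)))
      (2 * gaussCdf (hitThreshold y s) / y ^ 2) y := by
  have hs' : √s ≠ 0 := (Real.sqrt_pos.2 hs).ne'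
  have ht := hasDerivAt_hitThreshold_left (s := s) hy
  have hΦ := (hasDerivAt_gaussCdf (hitThreshold y s)).comp y ht
  have hΦ' := (hasDerivAt_gaussCdf (hitThreshold y s - √s)).comp y (ht.sub_const (√s))
  have := (((hΦ.div (hasDerivAt_id y) hy.ne').neg).add hΦ').const_mul 2
  refine this.congr_deriv ?_
  have hm := mul_gaussDensity_hitThreshold hy hs
  simp only [Function.comp, id]
  rw [← hm]
  field_simp
  ring

lemma hasDerivAt_barrier_right {y s : ℝ} (hy : 0 < y) (hs : 0 < s) :
    HasDerivAt (fun s => barrier y s) (gaussCdf (hitThreshold y s)) s := by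
  have hs' : √s ≠ 0 := (Real.sqrt_pos.2 hs).ne'
  have h1 : hitThreshold y s * √s = -Real.log y + s / 2 := by
    rw [hitThreshold]; field_simp
  have hq := Real.hasDerivAt_sqrt hs.ne'
  have hl : HasDerivAt (fun s : ℝ => -Real.log y + s / 2) (1 / 2) s :=
    ((hasDerivAt_id s).div_const 2).const_add _
  have ht : HasDerivAt (fun s => hitThreshold y s) _ s := hl.div hq hs'
  obtain ⟨t', ht'⟩ : ∃ t', t' = (1 / 2 * √s - (-Real.log y + s / 2) * (1 / (2 * √s))) / √s ^ 2 :=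
    ⟨_, rfl⟩
  rw [← ht'] at ht
  have hΦ := (hasDerivAt_gaussCdf (hitThreshold y s)).comp s ht
  have hφ := (hasDerivAt_gaussDensity (hitThreshold y s)).comp s ht
  have hΦ' := (hasDerivAt_gaussCdf (hitThreshold y s - √s)).comp s (ht.sub hq)
  have := ((((hl.sub_const 1).mul hΦ).add (hq.mul hφ)).add (hΦ'.const_mul y)).const_mul 2
  refine this.congr_deriv ?_
  have hm := mul_gaussDensity_hitThreshold hy hs
  simp only [Function.comp]
  rw [← h1]
  generalize gaussCdf (hitThreshold y s) = a at *
  generalize gaussDensity (hitThreshold y s - √s) = c at *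
  rw [← hm]
  generalize hitThreshold y s = d at *
  field_simp
  ring

lemma continuousAt_barrier {y s : ℝ} (hy : 0 < y) (hs : 0 < s) :
    ContinuousAt (fun q : ℝ × ℝ => barrier q.1 q.2) (y, s) := by
  have hs' : √s ≠ 0 := (Real.sqrt_pos.2 hs).ne'
  have hl : ContinuousAt (fun q : ℝ × ℝ => Real.log q.1) (y, s) :=
    ContinuousAt.comp (f := Prod.fst) (Real.continuousAt_log hy.ne') continuousAt_fst
  have hq : ContinuousAt (fun q : ℝ × ℝ => √q.2) (y, s) :=
    (Real.continuous_sqrt.comp continuous_snd).continuousAt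
  have ht : ContinuousAt (fun q : ℝ × ℝ => hitThreshold q.1 q.2) (y, s) :=
    (hl.neg.add (continuousAt_snd.div_const 2)).div hq hs'
  have hc : Continuous gaussCdf :=
    continuous_iff_continuousAt.2 fun u => (hasDerivAt_gaussCdf u).continuousAt
  have h1 := hc.continuousAt.comp ht
  have h2 := continuous_gaussDensity.continuousAt.comp ht
  have h3 := hc.continuousAt.comp (ht.sub hq)
  exact continuousAt_const.mul ((((((hl.neg.add (continuousAt_snd.div_const 2)).sub
    continuousAt_const).mul h1).add (hq.mul h2)).add (continuousAt_fst.mul h3)))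

/-! ### Counting integer points -/

/-- The squared Euclidean norm of an integer vector. -/
def intNormSq {n : ℕ} (x : Fin n → ℤ) : ℝ := ∑ i, (x i : ℝ) ^ 2

lemma one_le_intNormSq {n : ℕ} {x : Fin n → ℤ} (hx : x ≠ 0) : 1 ≤ intNormSq x := by
  obtain ⟨i, hi⟩ := Function.ne_iff.1 hx
  have h1 : (1 : ℝ) ≤ (x i : ℝ) ^ 2 := by
    have : (1 : ℤ) ≤ x i ^ 2 := by
      have := sq_pos_of_ne_zero (show x i ≠ 0 from hi)
      omega
    exact_mod_cast this
  exact h1.trans (Finset.single_le_sum (f := fun i => (x i : ℝ) ^ 2)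
    (fun j _ => sq_nonneg _) (Finset.mem_univ i))

lemma finite_intNormSq_le {n : ℕ} (C : ℝ) : {x : Fin n → ℤ | intNormSq x ≤ C}.Finite := by
  refine (Set.finite_Icc (fun _ : Fin n => -⌈C⌉) (fun _ => ⌈C⌉)).subset fun x hx => ?_
  have h : ∀ i, |x i| ≤ ⌈C⌉ := fun i => by
    have h1 : (x i : ℝ) ^ 2 ≤ C := (Finset.single_le_sum (f := fun i => (x i : ℝ) ^ 2)
      (fun j _ => sq_nonneg _) (Finset.mem_univ i)).trans hx
    have h2 : (x i ^ 2 : ℤ) ≤ ⌈C⌉ := by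
      have := h1.trans (Int.le_ceil C)
      exact_mod_cast this
    refine le_trans ?_ h2
    rcases eq_or_ne (x i) 0 with h0 | h0
    · simp [h0]
    · rw [← sq_abs]
      have := abs_pos.2 h0
      nlinarith
  exact ⟨fun i => (abs_le.1 (h i)).1, fun i => (abs_le.1 (h i)).2⟩

/-- The volume of the Euclidean unit ball. -/
def ballVol (n : ℕ) : ℝ := volume.real (Metric.ball (0 : Euc n) 1)

lemma ballVol_pos (n : ℕ) : 0 < ballVol n :=
  ENNReal.toReal_pos (Metric.measure_ball_pos _ _ one_pos).ne' measure_ball_lt_top.ne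

lemma volume_real_sum_sq_le_one {n : ℕ} (hn : n ≠ 0) :
    volume.real {x : Fin n → ℝ | ∑ i, x i ^ 2 ≤ 1} = ballVol n := by
  have : NeZero n := ⟨hn⟩
  have hm : MeasurePreserving (MeasurableEquiv.toLp 2 (Fin n → ℝ)) :=
    (EuclideanSpace.volume_preserving_symm_measurableEquiv_toLp (Fin n)).symm
  have h1 : {x : Fin n → ℝ | ∑ i, x i ^ 2 ≤ 1} =
      (MeasurableEquiv.toLp 2 (Fin n → ℝ)) ⁻¹' Metric.closedBall (0 : Euc n) 1 := by
    ext x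
    simp [EuclideanSpace.norm_eq, Real.sqrt_le_iff]
  rw [h1, Measure.real, hm.measure_preimage_equiv, ← Measure.real, ballVol, Measure.real,
    Measure.real, Measure.addHaar_closedBall_eq_addHaar_ball _ _ 1]

open scoped Pointwise in
lemma exists_card_le_of_one_le {n : ℕ} (hn : n ≠ 0) :
    ∃ R₀ : ℝ, 0 < R₀ ∧ ∀ R, R₀ ≤ R →
      ({x : Fin n → ℤ | intNormSq x ≤ R ^ 2}.ncard : ℝ) ≤ 2 * ballVol n * R ^ n := by
  have : NeZero n := ⟨hn⟩
  set s : Set (Fin n → ℝ) := {x | ∑ i, x i ^ 2 ≤ 1} with hs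
  have hcont : Continuous fun x : Fin n → ℝ => ∑ i, x i ^ 2 := by fun_prop
  have hconv : Convex ℝ s := by
    have h : ConvexOn ℝ Set.univ fun x : Fin n → ℝ => ∑ i, x i ^ 2 := by
      refine ⟨convex_univ, fun x _ y _ a b ha hb hab => ?_⟩
      simp only [smul_eq_mul, Finset.mul_sum, ← Finset.sum_add_distrib, Pi.add_apply,
        Pi.smul_apply]
      refine Finset.sum_le_sum fun i _ => ?_
      obtain rfl : b = 1 - a := by linarith
      nlinarith [mul_nonneg (mul_nonneg ha hb) (sq_nonneg (x i - y i))]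
    simpa [hs] using h.convex_le 1
  have hbdd : Bornology.IsBounded s := by
    refine (Metric.isBounded_closedBall (x := (0 : Fin n → ℝ)) (r := 1)).subset fun x hx => ?_
    rw [mem_closedBall_zero_iff, pi_norm_le_iff_of_nonneg zero_le_one]
    intro i
    rw [Real.norm_eq_abs, ← sq_le_one_iff_abs_le_one]
    exact (Finset.single_le_sum (f := fun i => x i ^ 2)
      (fun j _ => sq_nonneg _) (Finset.mem_univ i)).trans hx
  have hmeas : MeasurableSet s := (isClosed_le hcont continuous_const).measurableSet
  have hmono : ∀ ⦃x y : ℝ⦄, 0 < x → x ≤ y → x • s ⊆ y • s := by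
    rintro x y hx hxy _ ⟨z, hz, rfl⟩
    have hy : 0 < y := hx.trans_le hxy
    refine ⟨(x / y) • z, ?_, ?_⟩
    · have := hconv.smul_mem_of_zero_mem (show (0 : Fin n → ℝ) ∈ s by simp [hs]) hz
        (t := x / y) ⟨by positivity, (div_le_one hy).2 hxy⟩
      exact this
    · simp only [smul_smul]
      rw [mul_div_cancel₀ _ hy.ne']
  have ht := tendsto_card_div_pow_atTop_volume' s hbdd hmeas (hconv.addHaar_frontier volume) hmono
  rw [volume_real_sum_sq_le_one hn] at ht
  have hev := ht.eventually (gt_mem_nhds (show ballVol n < 2 * ballVol n by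
    linarith [ballVol_pos n]))
  obtain ⟨R₁, hR₁⟩ := Filter.eventually_atTop.1 hev
  refine ⟨max R₁ 1, by positivity, fun R hR => ?_⟩
  have hR0 : 0 < R := lt_of_lt_of_le (by positivity) hR
  have h := hR₁ R ((le_max_left _ _).trans hR)
  rw [Fintype.card_fin, div_lt_iff₀ (by positivity)] at h
  refine le_trans (le_of_eq ?_) h.le
  congr 1
  have himg : s ∩ R⁻¹ • (Submodule.span ℤ (Set.range (Pi.basisFun ℝ (Fin n))) : Set (Fin n → ℝ)) =
      (fun z : Fin n → ℤ => R⁻¹ • (fun i => (z i : ℝ))) '' {x | intNormSq x ≤ R ^ 2} := by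
    have hnorm : ∀ z : Fin n → ℤ, R⁻¹ • (fun i => (z i : ℝ)) ∈ s ↔ intNormSq z ≤ R ^ 2 := by
      intro z
      simp only [hs, Set.mem_ofPred_eq, Pi.smul_apply, smul_eq_mul, mul_pow, ← Finset.mul_sum]
      rw [← intNormSq, inv_pow, inv_mul_le_iff₀ (by positivity), mul_one]
    ext w
    constructor
    · rintro ⟨hw, v, hv, rfl⟩
      rw [SetLike.mem_coe, Module.Basis.mem_span_iff_repr_mem] at hv
      choose z hz using hv
      have : v = fun i => (z i : ℝ) := by
        ext i
        have := hz i
        simpa using this.symm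
      subst this
      exact ⟨z, (hnorm z).1 hw, rfl⟩
    · rintro ⟨z, hz, rfl⟩
      refine ⟨(hnorm z).2 hz, Set.smul_mem_smul_set ?_⟩
      rw [SetLike.mem_coe, Module.Basis.mem_span_iff_repr_mem]
      exact fun i => ⟨z i, by simp⟩
  rw [himg, Nat.card_coe_set_eq, Set.ncard_image_of_injective]
  intro z z' hzz
  ext i
  have := congrFun hzz i
  simpa [hR0.ne'] using this

lemma exists_card_filter_le {n : ℕ} (hn : n ≠ 0) :
    ∃ M : ℝ, 0 ≤ M ∧ ∀ F : Finset (Fin n → ℤ), 0 ∉ F → ∀ R : ℝ, 0 < R →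
      ((F.filter fun x => intNormSq x ≤ R ^ 2).card : ℝ) ≤ 2 * ballVol n * R ^ n + M * R := by
  obtain ⟨R₀, hR₀, h⟩ := exists_card_le_of_one_le hn
  have hκ := ballVol_pos n
  refine ⟨({x : Fin n → ℤ | intNormSq x ≤ R₀ ^ 2}.ncard : ℝ), by positivity,
    fun F hF R hR => ?_⟩
  have hle : ∀ R' : ℝ, R ≤ R' → ((F.filter fun x => intNormSq x ≤ R ^ 2).card : ℝ) ≤
      ({x : Fin n → ℤ | intNormSq x ≤ R' ^ 2}.ncard : ℝ) := by
    intro R' hR'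
    rw [← Set.ncard_coe_finset, Nat.cast_le]
    refine Set.ncard_le_ncard (fun x hx => ?_) (finite_intNormSq_le _)
    simp only [Finset.coe_filter, Set.mem_ofPred_eq] at hx ⊢
    exact hx.2.trans (by gcongr)
  rcases le_total R₀ R with h1 | h1
  · refine ((hle R le_rfl).trans (h R h1)).trans ?_
    have : 0 ≤ ({x : Fin n → ℤ | intNormSq x ≤ R₀ ^ 2}.ncard : ℝ) * R := by positivity
    linarith
  · rcases lt_or_ge R 1 with h2 | h2
    · rw [Finset.filter_eq_empty_iff.2]
      · simp only [Finset.card_empty, Nat.cast_zero]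
        positivity
      · intro x hx hx'
        have := one_le_intNormSq (show x ≠ 0 from fun h0 => hF (h0 ▸ hx))
        nlinarith
    · refine (hle R₀ h1).trans ?_
      have : 0 ≤ 2 * ballVol n * R ^ n := by positivity
      have h3 : (0 : ℝ) ≤ ({x : Fin n → ℤ | intNormSq x ≤ R₀ ^ 2}.ncard : ℝ) := by positivity
      nlinarith

/-! ### Lattice sums of the barrier -/

lemma integral_exp_affine_gaussianReal (a b : ℝ) :
    ∫ g, Real.exp (a + b * g) ∂(ProbabilityTheory.gaussianReal 0 1) =
      Real.exp (a + b ^ 2 / 2) := by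
  have h := congrFun (ProbabilityTheory.mgf_fun_id_gaussianReal (μ := 0) (v := 1)) b
  simp only [ProbabilityTheory.mgf] at h
  simp_rw [Real.exp_add, integral_const_mul, h]
  simp

lemma integrable_exp_affine_gaussianReal (a b : ℝ) :
    Integrable (fun g => Real.exp (a + b * g)) (ProbabilityTheory.gaussianReal 0 1) := by
  simp_rw [Real.exp_add]
  exact (ProbabilityTheory.integrable_exp_mul_gaussianReal b).const_mul _

lemma sum_gaussCdf_hitThreshold_le {n : ℕ} {M : ℝ} {F : Finset (Fin n → ℤ)} (hF : 0 ∉ F)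
    (hM : ∀ R : ℝ, 0 < R → ((F.filter fun x => intNormSq x ≤ R ^ 2).card : ℝ) ≤
      2 * ballVol n * R ^ n + M * R) (l : ℝ) {r : ℝ} (hr : 0 < r) :
    ∑ x ∈ F, gaussCdf (hitThreshold (Real.exp l * intNormSq x) r) ≤
      2 * ballVol n * Real.exp (-(n * l / 2) + n * (n + 2) / 8 * r) +
        M * Real.exp (-(l / 2) + 3 / 8 * r) := by
  have hsr : 0 < √r := Real.sqrt_pos.2 hr
  have hrr : √r ^ 2 = r := Real.sq_sqrt hr.le
  set γ := ProbabilityTheory.gaussianReal 0 1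
  set ρ : ℝ → ℝ := fun g => Real.exp (-(l + √r * g - r / 2) / 2) with hρ
  have hmem : ∀ x ∈ F, ∀ g, g ≤ hitThreshold (Real.exp l * intNormSq x) r ↔
      intNormSq x ≤ ρ g ^ 2 := by
    intro x hx g
    have hx1 := one_le_intNormSq (show x ≠ 0 from fun h0 => hF (h0 ▸ hx))
    have hx0 : 0 < intNormSq x := by linarith
    rw [hitThreshold, le_div_iff₀ hsr, Real.log_mul (Real.exp_pos l).ne' hx0.ne', Real.log_exp,
      hρ, ← Real.exp_nat_mul, ← Real.log_le_iff_le_exp hx0]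
    push_cast
    constructor <;> intro h <;> linarith
  have h1 : ∑ x ∈ F, gaussCdf (hitThreshold (Real.exp l * intNormSq x) r) =
      ∫ g, ((F.filter fun x => intNormSq x ≤ ρ g ^ 2).card : ℝ) ∂γ := by
    have h2 : ∀ g, ((F.filter fun x => intNormSq x ≤ ρ g ^ 2).card : ℝ) =
        ∑ x ∈ F, (Set.Iic (hitThreshold (Real.exp l * intNormSq x) r)).indicator 1 g := by
      intro g
      rw [Finset.card_filter]
      push_cast
      refine Finset.sum_congr rfl fun x hx => ?_
      simp only [Set.indicator_apply, Set.mem_Iic, hmem x hx g, Pi.one_apply]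
    simp_rw [h2]
    rw [integral_finsetSum _ fun x _ => (integrable_indicator_iff measurableSet_Iic).2
      (show Integrable (1 : ℝ → ℝ) γ from integrable_const (1 : ℝ)).integrableOn]
    refine Finset.sum_congr rfl fun x _ => ?_
    rw [integral_indicator_one measurableSet_Iic, gaussCdf]
  have hpow : ∀ g, 2 * ballVol n * ρ g ^ n + M * ρ g =
      2 * ballVol n * Real.exp ((-(n * l / 2) + n * r / 4) + (-(n * √r / 2)) * g) +
        M * Real.exp ((-(l / 2) + r / 4) + (-(√r / 2)) * g) := by
    intro g
    simp only [hρ, ← Real.exp_nat_mul]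
    congr 3 <;> ring
  have h_int1 := (integrable_exp_affine_gaussianReal (-(n * l / 2) + n * r / 4)
    (-(n * √r / 2))).const_mul (2 * ballVol n)
  have h_int2 := (integrable_exp_affine_gaussianReal (-(l / 2) + r / 4)
    (-(√r / 2))).const_mul M
  rw [h1]
  calc ∫ g, ((F.filter fun x => intNormSq x ≤ ρ g ^ 2).card : ℝ) ∂γ
      ≤ ∫ g, (2 * ballVol n * Real.exp ((-(n * l / 2) + n * r / 4) + (-(n * √r / 2)) * g) +
        M * Real.exp ((-(l / 2) + r / 4) + (-(√r / 2)) * g)) ∂γ := by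
        refine integral_mono_of_nonneg (Filter.Eventually.of_forall fun g => by positivity)
          (h_int1.add h_int2) (Filter.Eventually.of_forall fun g => ?_)
        simp only [← hpow]
        exact hM _ (Real.exp_pos _)
    _ = _ := by
        rw [integral_add h_int1 h_int2, integral_const_mul, integral_const_mul,
          integral_exp_affine_gaussianReal, integral_exp_affine_gaussianReal]
        congr 3
        · linear_combination ((n : ℝ) ^ 2 / 8) * hrr
        · linear_combination (1 / 8 : ℝ) * hrr

lemma sum_barrier_sub_le {n : ℕ} (hn : n ≠ 0) {M : ℝ} (hM0 : 0 ≤ M)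
    {F : Finset (Fin n → ℤ)} (hF : 0 ∉ F)
    (hM : ∀ R : ℝ, 0 < R → ((F.filter fun x => intNormSq x ≤ R ^ 2).card : ℝ) ≤
      2 * ballVol n * R ^ n + M * R) (l : ℝ) {s T : ℝ} (hs : 0 < s) (hsT : s ≤ T) :
    ∑ x ∈ F, (barrier (Real.exp l * intNormSq x) T - barrier (Real.exp l * intNormSq x) s) ≤
      2 * ballVol n / (n * (n + 2) / 8) * Real.exp (-(n * l / 2) + n * (n + 2) / 8 * T) +
        M * (8 / 3) * Real.exp (-(l / 2) + 3 / 8 * T) := by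
  have hn' : (0 : ℝ) < n := by positivity
  have hκ := ballVol_pos n
  set B : ℝ → ℝ := fun r =>
    2 * ballVol n / (n * (n + 2) / 8) * Real.exp (-(n * l / 2) + n * (n + 2) / 8 * r) +
        M * (8 / 3) * Real.exp (-(l / 2) + 3 / 8 * r) with hB
  have hBpos : 0 ≤ B s := by positivity
  have hB' : ∀ r, HasDerivAt B
      (2 * ballVol n * Real.exp (-(n * l / 2) + n * (n + 2) / 8 * r) +
        M * Real.exp (-(l / 2) + 3 / 8 * r)) r := by
    intro r
    have h1 := ((((hasDerivAt_id r).const_mul ((n : ℝ) * (n + 2) / 8)).const_add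
      (-(n * l / 2))).exp).const_mul (2 * ballVol n / (n * (n + 2) / 8))
    have h2 := ((((hasDerivAt_id r).const_mul (3 / 8 : ℝ)).const_add
      (-(l / 2))).exp).const_mul (M * (8 / 3))
    refine (h1.add h2).congr_deriv ?_
    simp only [id]
    field_simp
  set D : ℝ → ℝ := fun r => B r - ∑ x ∈ F, barrier (Real.exp l * intNormSq x) r with hD
  have hD' : ∀ r, 0 < r → HasDerivAt D
      ((2 * ballVol n * Real.exp (-(n * l / 2) + n * (n + 2) / 8 * r) +
        M * Real.exp (-(l / 2) + 3 / 8 * r)) -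
        ∑ x ∈ F, gaussCdf (hitThreshold (Real.exp l * intNormSq x) r)) r := by
    intro r hr
    refine (hB' r).sub (HasDerivAt.fun_sum fun x hx => ?_)
    have hx1 := one_le_intNormSq (show x ≠ 0 from fun h0 => hF (h0 ▸ hx))
    exact hasDerivAt_barrier_right (by positivity) hr
  have hmono : MonotoneOn D (Set.Icc s T) := by
    refine monotoneOn_of_deriv_nonneg (convex_Icc s T)
      (fun r hr => (hD' r (hs.trans_le hr.1)).continuousAt.continuousWithinAt)
      (fun r hr => (hD' r (hs.trans_le (interior_subset hr).1)).differentiableAt.differentiableWithinAt)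
      fun r hr => ?_
    have hr0 : 0 < r := hs.trans_le (interior_subset hr).1
    rw [(hD' r hr0).deriv, sub_nonneg]
    exact sum_gaussCdf_hitThreshold_le hF hM l hr0
  have := hmono ⟨le_rfl, hsT⟩ ⟨hsT, le_rfl⟩ hsT
  rw [Finset.sum_sub_distrib]
  simp only [hD] at this
  change _ ≤ B T
  linarith

/-! ### Perturbations of quadratic forms -/

lemma det_le_exp_trace_sub {n : ℕ} {P : Matrix (Fin n) (Fin n) ℝ} (hP : P.PosSemidef) :
    P.det ≤ Real.exp (P.trace - n) := by
  rw [hP.1.det_eq_prod_eigenvalues, hP.1.trace_eq_sum_eigenvalues]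
  have h : ((∑ i, (hP.1.eigenvalues i : ℝ)) - n) = ∑ i, (hP.1.eigenvalues i - 1) := by
    simp [Finset.sum_sub_distrib]
  simp only [RCLike.ofReal_real_eq_id, id]
  rw [h, Real.exp_sum]
  refine Finset.prod_le_prod (fun i _ => hP.eigenvalues_nonneg i) fun i _ => ?_
  linarith [Real.add_one_le_exp (hP.1.eigenvalues i - 1)]

lemma sq_dotProduct_mulVec_le {n : ℕ} {S : Matrix (Fin n) (Fin n) ℝ}
    (hS : ∑ i, ∑ j, S i j ^ 2 = 1) (v : Fin n → ℝ) : (S.mulVec v) ⬝ᵥ (S.mulVec v) ≤ v ⬝ᵥ v := by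
  have h : ∀ i, S.mulVec v i ^ 2 ≤ (∑ j, S i j ^ 2) * ∑ j, v j ^ 2 := fun i => by
    simpa [Matrix.mulVec, dotProduct] using
      Finset.sum_mul_sq_le_sq_mul_sq Finset.univ (fun j => S i j) v
  calc (S.mulVec v) ⬝ᵥ (S.mulVec v) = ∑ i, S.mulVec v i ^ 2 := by
        simp [dotProduct, sq]
    _ ≤ ∑ i, (∑ j, S i j ^ 2) * ∑ j, v j ^ 2 := Finset.sum_le_sum fun i _ => h i
    _ = v ⬝ᵥ v := by rw [← Finset.sum_mul, hS, one_mul]; simp [dotProduct, sq]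

lemma abs_dotProduct_mulVec_le {n : ℕ} {S : Matrix (Fin n) (Fin n) ℝ}
    (hS : ∑ i, ∑ j, S i j ^ 2 = 1) (v : Fin n → ℝ) : |v ⬝ᵥ S.mulVec v| ≤ v ⬝ᵥ v := by
  have h1 := sq_dotProduct_mulVec_le hS v
  have h0 : 0 ≤ v ⬝ᵥ v := Finset.sum_nonneg fun i _ => mul_self_nonneg _
  have h2 : (v ⬝ᵥ S.mulVec v) ^ 2 ≤ (v ⬝ᵥ v) * ((S.mulVec v) ⬝ᵥ (S.mulVec v)) := by
    simpa [dotProduct, sq] using Finset.sum_mul_sq_le_sq_mul_sq Finset.univ v (S.mulVec v)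
  exact abs_le_of_sq_le_sq (by nlinarith) h0

lemma det_one_add_mul_det_one_sub_le {n : ℕ} {S : Matrix (Fin n) (Fin n) ℝ} (hsymm : S.IsSymm)
    (hS : ∑ i, ∑ j, S i j ^ 2 = 1) {ε : ℝ} (hε : ε ^ 2 ≤ 1) :
    (1 + ε • S).det * (1 - ε • S).det ≤ Real.exp (-ε ^ 2) := by
  have hmul : (1 + ε • S) * (1 - ε • S) = 1 - ε ^ 2 • (S * S) := by
    rw [add_mul, mul_sub, mul_sub, smul_mul_smul_comm, sq]
    simp
  have htr : (S * S).trace = 1 := by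
    rw [← hS, Matrix.trace]
    refine Finset.sum_congr rfl fun i _ => ?_
    rw [Matrix.diag_apply, Matrix.mul_apply]
    refine Finset.sum_congr rfl fun j _ => ?_
    rw [sq, hsymm.apply i j]
  have hSt : S.transpose = S := hsymm
  have hP : (1 - ε ^ 2 • (S * S)).PosSemidef := by
    refine Matrix.PosSemidef.of_dotProduct_mulVec_nonneg ?_ fun v => ?_
    · rw [Matrix.IsHermitian, Matrix.conjTranspose_eq_transpose_of_trivial]
      simp [Matrix.transpose_mul, hSt]
    · have h1 := sq_dotProduct_mulVec_le hS v
      have h0 : 0 ≤ v ⬝ᵥ v := Finset.sum_nonneg fun i _ => mul_self_nonneg _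
      have h2 : v ⬝ᵥ (S * S).mulVec v = (S.mulVec v) ⬝ᵥ (S.mulVec v) := by
        rw [← Matrix.mulVec_mulVec, Matrix.dotProduct_mulVec, ← Matrix.mulVec_transpose, hSt]
      have h3 : 0 ≤ (S.mulVec v) ⬝ᵥ (S.mulVec v) :=
        Finset.sum_nonneg fun i _ => mul_self_nonneg _
      rw [star_trivial, Matrix.sub_mulVec, Matrix.one_mulVec, Matrix.smul_mulVec,
        dotProduct_sub, dotProduct_smul, h2, smul_eq_mul]
      nlinarith
  rw [← Matrix.det_mul, hmul]
  refine (det_le_exp_trace_sub hP).trans (le_of_eq ?_)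
  rw [Matrix.trace_sub, Matrix.trace_one, Matrix.trace_smul, htr]
  simp

/-- Orthonormal symmetric traceless matrices whose quadratic forms vanish at given vectors. -/
lemma exists_orthonormal_symm {n : ℕ} (hn : n ≠ 0) {κ : Type*} [Fintype κ]
    (u : κ → Fin n → ℝ) :
    ∃ (m : ℕ) (S : Fin m → Matrix (Fin n) (Fin n) ℝ),
      ((n : ℝ) - 1) * (n + 2) / 2 - Fintype.card κ ≤ m ∧
      (∀ i, (S i).IsSymm) ∧ (∀ i, ∑ a, ∑ b, S i a b ^ 2 = 1) ∧
      (∀ i k, u k ⬝ᵥ (S i).mulVec (u k) = 0) ∧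
      ∀ v : Fin n → ℝ, ∑ i, (v ⬝ᵥ (S i).mulVec v) ^ 2 ≤ (1 - 1 / (n : ℝ)) * (v ⬝ᵥ v) ^ 2 := by
  have hn' : (0 : ℝ) < n := by positivity
  let tens : (Fin n → ℝ) → EuclideanSpace ℝ (Fin n × Fin n) := fun v => WithLp.toLp 2 fun p => v p.1 * v p.2
  let idv : EuclideanSpace ℝ (Fin n × Fin n) := WithLp.toLp 2 fun p => if p.1 = p.2 then 1 else 0
  let g : ((j : Fin n) × Fin j) ⊕ (Unit ⊕ κ) → EuclideanSpace ℝ (Fin n × Fin n) := Sum.elim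
    (fun q => EuclideanSpace.single (⟨q.2, q.2.2.trans q.1.2⟩, q.1) (1 : ℝ)
      - EuclideanSpace.single (q.1, ⟨q.2, q.2.2.trans q.1.2⟩) (1 : ℝ))
    (Sum.elim (fun _ => idv) fun k => tens (u k))
  let W := (Submodule.span ℝ (Set.range g))ᗮ
  let b := stdOrthonormalBasis ℝ W
  have horth : ∀ i q, inner ℝ (g q) ((b i : W) : EuclideanSpace ℝ (Fin n × Fin n)) = 0 := fun i q =>
    (Submodule.mem_orthogonal _ _).1 (b i).2 _ (Submodule.subset_span ⟨q, rfl⟩)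
  have hon : Orthonormal ℝ fun i => ((b i : W) : EuclideanSpace ℝ (Fin n × Fin n)) :=
    b.orthonormal.comp_linearIsometry W.subtypeₗᵢ
  have htens : ∀ (w : EuclideanSpace ℝ (Fin n × Fin n)) (v : Fin n → ℝ), inner ℝ (tens v) w =
      v ⬝ᵥ (Matrix.of fun a c => w (a, c)).mulVec v := by
    intro w v
    simp only [tens, PiLp.inner_apply, dotProduct, Matrix.mulVec, Matrix.of_apply,
      Fintype.sum_prod_type, Finset.mul_sum, RCLike.inner_apply, conj_trivial]
    exact Finset.sum_congr rfl fun a _ => Finset.sum_congr rfl fun c _ => by ring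
  have hid : ∀ i, inner ℝ idv ((b i : W) : EuclideanSpace ℝ (Fin n × Fin n)) = 0 := fun i => horth i (Sum.inr (Sum.inl ()))
  refine ⟨_, fun i => Matrix.of fun a c => ((b i : W) : EuclideanSpace ℝ (Fin n × Fin n)) (a, c), ?_, ?_, ?_, ?_, ?_⟩
  · have h1 : Module.finrank ℝ (Submodule.span ℝ (Set.range g)) + Module.finrank ℝ W = n * n := by
      have := Submodule.finrank_add_finrank_orthogonal (Submodule.span ℝ (Set.range g))
      simpa using this
    have h2 : Module.finrank ℝ (Submodule.span ℝ (Set.range g)) ≤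
        (∑ j : Fin n, (j : ℕ)) + (1 + Fintype.card κ) := by
      have := finrank_range_le_card (R := ℝ) g
      simpa [Set.finrank] using this
    have h3 : (∑ j : Fin n, (j : ℕ)) * 2 = n * (n - 1) := by
      rw [Fin.sum_univ_eq_sum_range (fun j => j), Finset.sum_range_id_mul_two]
    have h3' : ((∑ j : Fin n, (j : ℕ) : ℕ) : ℝ) * 2 = n * (n - 1) := by
      have : ((n - 1 : ℕ) : ℝ) = n - 1 := by
        rw [Nat.cast_sub (by omega)]
        simp
      rw [← this]
      exact_mod_cast h3
    have h1' : (Module.finrank ℝ (Submodule.span ℝ (Set.range g)) : ℝ) + Module.finrank ℝ W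
      = n * n := by exact_mod_cast h1
    have h2' : (Module.finrank ℝ (Submodule.span ℝ (Set.range g)) : ℝ) ≤
        ((∑ j : Fin n, (j : ℕ) : ℕ) : ℝ) + (1 + Fintype.card κ) := by exact_mod_cast h2
    nlinarith
  · intro i
    have h : ∀ a c : Fin n, a < c → ((b i : W) : EuclideanSpace ℝ (Fin n × Fin n)) (a, c) = ((b i : W) : EuclideanSpace ℝ (Fin n × Fin n)) (c, a) := by
      intro a c hac
      have := horth i (Sum.inl ⟨c, ⟨a, hac⟩⟩)
      simp only [g, Sum.elim_inl, inner_sub_left, EuclideanSpace.inner_single_left] at this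
      simpa [sub_eq_zero] using this
    ext a c
    simp only [Matrix.transpose_apply, Matrix.of_apply]
    rcases lt_trichotomy a c with hac | hac | hac
    · exact (h a c hac).symm
    · rw [hac]
    · exact h c a hac
  · intro i
    have := hon.1 i
    rw [← sq_eq_sq₀ (norm_nonneg _) zero_le_one, EuclideanSpace.real_norm_sq_eq] at this
    simpa [Fintype.sum_prod_type] using this
  · intro i k
    rw [← htens]
    exact horth i (Sum.inr (Sum.inr k))
  · intro v
    have h1 := hon.sum_inner_products_le (x := tens v - ((v ⬝ᵥ v) / n) • idv)
      (s := Finset.univ)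
    have h2 : ∀ i, ‖inner ℝ ((b i : W) : EuclideanSpace ℝ (Fin n × Fin n)) (tens v - ((v ⬝ᵥ v) / n) • idv)‖ ^ 2 =
        (v ⬝ᵥ (Matrix.of fun a c => ((b i : W) : EuclideanSpace ℝ (Fin n × Fin n)) (a, c)).mulVec v) ^ 2 := by
      intro i
      rw [inner_sub_right, inner_smul_right, real_inner_comm idv, hid, real_inner_comm (tens v),
        htens, mul_zero, sub_zero, Real.norm_eq_abs, sq_abs]
    simp only [h2] at h1
    refine h1.trans (le_of_eq ?_)
    have h3 : inner ℝ (tens v) idv = v ⬝ᵥ v := by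
      rw [htens]
      simp [idv, dotProduct, Matrix.mulVec]
    have h4 : ‖idv‖ ^ 2 = n := by
      rw [EuclideanSpace.real_norm_sq_eq, Fintype.sum_prod_type]
      simp [idv]
    have h5 : ‖tens v‖ ^ 2 = (v ⬝ᵥ v) ^ 2 := by
      rw [EuclideanSpace.real_norm_sq_eq, sq (v ⬝ᵥ v), dotProduct, Finset.sum_mul_sum]
      simp only [tens, Fintype.sum_prod_type]
      exact Finset.sum_congr rfl fun a _ => Finset.sum_congr rfl fun c _ => by ring
    rw [norm_sub_sq_real, inner_smul_right, h3, norm_smul, mul_pow, h4, h5, Real.norm_eq_abs,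
      sq_abs]
    field_simp
    ring

/-! ### Positive definite forms that are at least one on the nonzero lattice points -/

def intVec {n : ℕ} (x : Fin n → ℤ) : Fin n → ℝ := fun i => (x i : ℝ)

def intForm {n : ℕ} (A : Matrix (Fin n) (Fin n) ℝ) (x : Fin n → ℤ) : ℝ :=
  intVec x ⬝ᵥ A.mulVec (intVec x)

/-- Positive definite matrices whose open ellipsoid contains no nonzero lattice point. -/
def admissible (n : ℕ) : Set (Matrix (Fin n) (Fin n) ℝ) :=
  {A | A.PosDef ∧ ∀ x : Fin n → ℤ, x ≠ 0 → 1 ≤ intForm A x}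

open scoped MatrixOrder Matrix.Norms.L2Operator in
lemma exists_transpose_mul_self_of_posDef {n : ℕ} {A : Matrix (Fin n) (Fin n) ℝ}
    (hA : A.PosDef) :
    ∃ M : Matrix (Fin n) (Fin n) ℝ, A = M.transpose * M ∧ M.det ≠ 0 := by
  obtain ⟨M, hM⟩ := CStarAlgebra.nonneg_iff_eq_star_mul_self.mp hA.posSemidef.nonneg
  have hM' : A = M.transpose * M := by
    rw [hM, Matrix.star_eq_conjTranspose, Matrix.conjTranspose_eq_transpose_of_trivial]
  refine ⟨M, hM', fun h => ?_⟩
  have := hA.det_pos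
  rw [hM', Matrix.det_mul, h] at this
  simp at this

lemma dotProduct_transpose_mul_mul_mulVec {n : ℕ} (M B : Matrix (Fin n) (Fin n) ℝ)
    (v : Fin n → ℝ) :
    v ⬝ᵥ (M.transpose * B * M).mulVec v = M.mulVec v ⬝ᵥ B.mulVec (M.mulVec v) := by
  rw [← Matrix.mulVec_mulVec, ← Matrix.mulVec_mulVec, Matrix.dotProduct_mulVec,
    Matrix.vecMul_transpose]

lemma dotProduct_transpose_mul_mulVec {n : ℕ} (M : Matrix (Fin n) (Fin n) ℝ) (v : Fin n → ℝ) :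
    v ⬝ᵥ (M.transpose * M).mulVec v = M.mulVec v ⬝ᵥ M.mulVec v := by
  simpa using dotProduct_transpose_mul_mul_mulVec M 1 v

lemma dotProduct_perturb_mulVec {n : ℕ} (M S : Matrix (Fin n) (Fin n) ℝ) (ε : ℝ)
    (v : Fin n → ℝ) :
    v ⬝ᵥ (M.transpose * (1 + ε • S) * M).mulVec v =
      v ⬝ᵥ (M.transpose * M).mulVec v + ε * (M.mulVec v ⬝ᵥ S.mulVec (M.mulVec v)) := by
  rw [dotProduct_transpose_mul_mul_mulVec, dotProduct_transpose_mul_mulVec, Matrix.add_mulVec,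
    Matrix.one_mulVec, Matrix.smul_mulVec, dotProduct_add, dotProduct_smul, smul_eq_mul]

lemma intVec_dotProduct_self {n : ℕ} (x : Fin n → ℤ) : intVec x ⬝ᵥ intVec x = intNormSq x := by
  simp [intVec, intNormSq, dotProduct, sq]

lemma continuous_dotProduct_mulVec {n : ℕ} :
    Continuous fun p : Matrix (Fin n) (Fin n) ℝ × (Fin n → ℝ) => p.2 ⬝ᵥ p.1.mulVec p.2 := by
  fun_prop

lemma exists_pos_mul_le_of_isCompact {n : ℕ} {C : Set (Matrix (Fin n) (Fin n) ℝ)}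
    (hC : IsCompact C) (hpos : ∀ A ∈ C, A.PosDef) :
    ∃ κ : ℝ, 0 < κ ∧ ∀ A ∈ C, ∀ v, κ * (v ⬝ᵥ v) ≤ v ⬝ᵥ A.mulVec v := by
  have hsph : IsCompact {v : Fin n → ℝ | v ⬝ᵥ v = 1} := by
    refine Metric.isCompact_of_isClosed_isBounded
      (isClosed_eq (by fun_prop) continuous_const) ?_
    refine (Metric.isBounded_closedBall (x := (0 : Fin n → ℝ)) (r := 1)).subset fun v hv => ?_
    rw [mem_closedBall_zero_iff, pi_norm_le_iff_of_nonneg zero_le_one]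
    intro i
    rw [Real.norm_eq_abs, ← sq_le_one_iff_abs_le_one, ← show v ⬝ᵥ v = 1 from hv, sq]
    exact Finset.single_le_sum (f := fun i => v i * v i) (fun i _ => mul_self_nonneg _)
      (Finset.mem_univ i)
  have hne0 : ∀ v : Fin n → ℝ, v ⬝ᵥ v = 1 → v ≠ 0 := by
    rintro v hv rfl
    simp at hv
  obtain ⟨κ, hκ, hle⟩ : ∃ κ : ℝ, 0 < κ ∧ ∀ A ∈ C, ∀ v : Fin n → ℝ, v ⬝ᵥ v = 1 →
      κ ≤ v ⬝ᵥ A.mulVec v := by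
    rcases (C ×ˢ {v : Fin n → ℝ | v ⬝ᵥ v = 1}).eq_empty_or_nonempty with he | hne
    · refine ⟨1, one_pos, fun A hA v hv => ?_⟩
      have : (A, v) ∈ C ×ˢ {v : Fin n → ℝ | v ⬝ᵥ v = 1} := ⟨hA, hv⟩
      simp [he] at this
    · obtain ⟨p, hp, hmin⟩ := (hC.prod hsph).exists_isMinOn hne
        continuous_dotProduct_mulVec.continuousOn
      refine ⟨_, ?_, fun A hA v hv => hmin (show (A, v) ∈ _ from ⟨hA, hv⟩)⟩
      simpa using (hpos p.1 hp.1).dotProduct_mulVec_pos (hne0 p.2 hp.2)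
  refine ⟨κ, hκ, fun A hA v => ?_⟩
  have h0 : 0 ≤ v ⬝ᵥ v := Finset.sum_nonneg fun i _ => mul_self_nonneg _
  rcases h0.eq_or_lt with h | h
  · rw [← h, mul_zero]
    simpa using (hpos A hA).posSemidef.dotProduct_mulVec_nonneg v
  · set t := √(v ⬝ᵥ v) with ht
    have ht0 : 0 < t := Real.sqrt_pos.2 h
    have htt : t * t = v ⬝ᵥ v := Real.mul_self_sqrt h0
    have h1 := hle A hA (t⁻¹ • v) (by
      rw [smul_dotProduct, dotProduct_smul, ← htt, smul_eq_mul, smul_eq_mul]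
      field_simp)
    rw [Matrix.mulVec_smul, smul_dotProduct, dotProduct_smul, smul_eq_mul, smul_eq_mul] at h1
    rw [← htt]
    have : t⁻¹ * (t⁻¹ * (v ⬝ᵥ A.mulVec v)) * (t * t) = v ⬝ᵥ A.mulVec v := by field_simp
    nlinarith [mul_le_mul_of_nonneg_right h1 (mul_pos ht0 ht0).le]

lemma finite_intForm_le_of_isCompact {n : ℕ} {C : Set (Matrix (Fin n) (Fin n) ℝ)}
    (hC : IsCompact C) (hpos : ∀ A ∈ C, A.PosDef) (r : ℝ) :
    {x : Fin n → ℤ | ∃ A ∈ C, intForm A x ≤ r}.Finite := by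
  obtain ⟨κ, hκ, hle⟩ := exists_pos_mul_le_of_isCompact hC hpos
  refine (finite_intNormSq_le (r / κ)).subset ?_
  rintro x ⟨A, hA, hx⟩
  have := hle A hA (intVec x)
  rw [intVec_dotProduct_self] at this
  rw [Set.mem_ofPred_eq, le_div_iff₀ hκ, mul_comm]
  exact this.trans hx

lemma eventually_perturb_mem_admissible {n : ℕ} {M S : Matrix (Fin n) (Fin n) ℝ}
    (hA : M.transpose * M ∈ admissible n) (hsymm : S.IsSymm)
    (hS : ∑ i, ∑ j, S i j ^ 2 = 1)
    (hc : ∀ x : Fin n → ℤ, x ≠ 0 → intForm (M.transpose * M) x = 1 →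
      M.mulVec (intVec x) ⬝ᵥ S.mulVec (M.mulVec (intVec x)) = 0) :
    ∀ᶠ ε : ℝ in nhds 0, M.transpose * (1 + ε • S) * M ∈ admissible n := by
  have hfin := finite_intForm_le_of_isCompact (isCompact_singleton (x := M.transpose * M))
    (by simpa using hA.1) 2
  have hev : ∀ᶠ ε : ℝ in nhds 0, ∀ x ∈ {x : Fin n → ℤ | ∃ A ∈ ({M.transpose * M} : Set _),
      intForm A x ≤ 2}, x ≠ 0 → 1 ≤ intForm (M.transpose * (1 + ε • S) * M) x := by
    rw [Filter.eventually_all_finite hfin]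
    intro x _
    by_cases hx0 : x = 0
    · simp [hx0]
    rcases (hA.2 x hx0).eq_or_lt with h | h
    · refine Filter.Eventually.of_forall fun ε _ => ?_
      rw [intForm, dotProduct_perturb_mulVec, hc x hx0 h.symm, mul_zero, add_zero]
      exact h.le
    · have hcont : Continuous fun ε : ℝ => intForm (M.transpose * (1 + ε • S) * M) x := by
        simp only [intForm, dotProduct_perturb_mulVec]
        fun_prop
      have h0 : (1 : ℝ) < intForm (M.transpose * (1 + (0 : ℝ) • S) * M) x := by simpa using h
      filter_upwards [hcont.continuousAt.eventually (lt_mem_nhds h0)] with ε hε _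
      exact hε.le
  have hsmall : ∀ᶠ ε : ℝ in nhds 0, |ε| < 1 / 2 := by
    have : Continuous fun ε : ℝ => |ε| := continuous_abs
    exact this.continuousAt.eventually (gt_mem_nhds (by norm_num))
  filter_upwards [hev, hsmall] with ε h1 h2
  have hlow : ∀ v : Fin n → ℝ, (M.mulVec v ⬝ᵥ M.mulVec v) / 2 ≤
      v ⬝ᵥ (M.transpose * (1 + ε • S) * M).mulVec v := by
    intro v
    rw [dotProduct_perturb_mulVec, dotProduct_transpose_mul_mulVec]
    have h3 := abs_dotProduct_mulVec_le hS (M.mulVec v)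
    have h4 : |ε * (M.mulVec v ⬝ᵥ S.mulVec (M.mulVec v))| ≤
        1 / 2 * (M.mulVec v ⬝ᵥ M.mulVec v) := by
      rw [abs_mul]
      exact mul_le_mul h2.le h3 (abs_nonneg _) (by norm_num)
    linarith [neg_abs_le (ε * (M.mulVec v ⬝ᵥ S.mulVec (M.mulVec v)))]
  have hSt : S.transpose = S := hsymm
  refine ⟨Matrix.PosDef.of_dotProduct_mulVec_pos ?_ fun v hv => ?_, fun x hx => ?_⟩
  · rw [Matrix.IsHermitian, Matrix.conjTranspose_eq_transpose_of_trivial]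
    simp [Matrix.transpose_mul, hSt, Matrix.mul_assoc]
  · have h5 := hA.1.dotProduct_mulVec_pos hv
    rw [star_trivial, dotProduct_transpose_mul_mulVec] at h5
    rw [star_trivial]
    exact (half_pos h5).trans_le (hlow v)
  · by_cases h6 : intForm (M.transpose * M) x ≤ 2
    · exact h1 x ⟨_, rfl, h6⟩ hx
    · have h7 := hlow (intVec x)
      rw [← dotProduct_transpose_mul_mulVec] at h7
      have h8 : intForm (M.transpose * M) x / 2 ≤ intForm (M.transpose * (1 + ε • S) * M) x := h7
      linarith

lemma log_det_perturb_add_le {n : ℕ} {M S : Matrix (Fin n) (Fin n) ℝ} (hM : M.det ≠ 0)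
    (hsymm : S.IsSymm) (hS : ∑ i, ∑ j, S i j ^ 2 = 1) {ε : ℝ} (hε : ε ^ 2 ≤ 1)
    (hp : 0 < (M.transpose * (1 + ε • S) * M).det)
    (hm : 0 < (M.transpose * (1 + (-ε) • S) * M).det) :
    Real.log (M.transpose * (1 + ε • S) * M).det
      + Real.log (M.transpose * (1 + (-ε) • S) * M).det ≤
      2 * Real.log (M.transpose * M).det - ε ^ 2 := by
  have h2 : 0 < (M.transpose * M).det := by
    rw [Matrix.det_mul, Matrix.det_transpose]
    exact mul_self_pos.2 hM
  rw [← Real.log_mul hp.ne' hm.ne']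
  have h3 : (M.transpose * (1 + ε • S) * M).det * (M.transpose * (1 + (-ε) • S) * M).det =
      (M.transpose * M).det ^ 2 * ((1 + ε • S).det * (1 - ε • S).det) := by
    simp only [Matrix.det_mul, Matrix.det_transpose, neg_smul, ← sub_eq_add_neg]
    ring
  have h4 := det_one_add_mul_det_one_sub_le hsymm hS hε
  have h5 : (M.transpose * (1 + ε • S) * M).det * (M.transpose * (1 + (-ε) • S) * M).det ≤
      (M.transpose * M).det ^ 2 * Real.exp (-ε ^ 2) := by
    rw [h3]
    gcongr
  refine (Real.log_le_log (mul_pos hp hm) h5).trans (le_of_eq ?_)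
  rw [Real.log_mul (by positivity) (Real.exp_ne_zero _), Real.log_pow, Real.log_exp]
  push_cast
  ring

/-! ### Elementary necessary conditions for extrema -/

lemma tendsto_second_difference {f f' : ℝ → ℝ} {y a c : ℝ}
    (hf : ∀ᶠ z in nhds y, HasDerivAt f (f' z) z) (hf' : HasDerivAt f' c y) :
    Filter.Tendsto (fun ε : ℝ => (f (y + ε * a) + f (y + -ε * a) - 2 * f y) / ε ^ 2)
      (nhdsWithin 0 {0}ᶜ) (nhds (a ^ 2 * c)) := by
  have hlin : ∀ b : ℝ, Filter.Tendsto (fun ε : ℝ => y + ε * b) (nhds 0) (nhds y) := by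
    intro b
    have : Continuous fun ε : ℝ => y + ε * b := by fun_prop
    simpa using this.tendsto 0
  have hneg : (fun ε : ℝ => y + -ε * a) = fun ε => y + ε * (-a) := by
    ext ε
    ring
  have hfc := hf.self_of_nhds.continuousAt
  have hnum : ∀ᶠ ε : ℝ in nhds 0, HasDerivAt
      (fun ε : ℝ => f (y + ε * a) + f (y + -ε * a) - 2 * f y)
      (a * f' (y + ε * a) - a * f' (y + ε * (-a))) ε := by
    filter_upwards [(hlin a).eventually hf, (hlin (-a)).eventually hf] with ε h1 h2
    have hd : ∀ b : ℝ, HasDerivAt (fun ε : ℝ => y + ε * b) b ε := fun b => by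
      simpa using ((hasDerivAt_id ε).mul_const b).const_add y
    have e2 : (fun ε : ℝ => f (y + ε * a) + f (y + -ε * a) - 2 * f y) =
        fun ε => f (y + ε * a) + f (y + ε * (-a)) - 2 * f y := by
      ext ε
      rw [show y + -ε * a = y + ε * (-a) by ring]
    rw [e2]
    refine (((h1.comp ε (hd a)).add (h2.comp ε (hd (-a)))).sub_const (2 * f y)).congr_deriv ?_
    ring
  refine HasDerivAt.lhopital_zero_nhdsNE (f' := fun ε => a * f' (y + ε * a) - a * f' (y + ε * (-a)))
    (g' := fun ε => 2 * ε) (hnum.filter_mono nhdsWithin_le_nhds) ?_ ?_ ?_ ?_ ?_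
  · refine Filter.Eventually.of_forall fun ε => ?_
    simpa using hasDerivAt_pow 2 ε
  · filter_upwards [self_mem_nhdsWithin] with ε hε
    exact mul_ne_zero two_ne_zero hε
  · refine Filter.Tendsto.mono_left ?_ nhdsWithin_le_nhds
    have h1 : ContinuousAt (fun ε : ℝ => f (y + ε * a) + f (y + -ε * a) - 2 * f y) 0 :=
      hnum.self_of_nhds.continuousAt
    have h2 := h1.tendsto
    simp only [zero_mul, neg_zero, add_zero] at h2
    convert h2 using 2
    ring
  · refine Filter.Tendsto.mono_left ?_ nhdsWithin_le_nhds
    have : Continuous fun ε : ℝ => ε ^ 2 := by fun_prop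
    simpa using this.tendsto 0
  · have hk : HasDerivAt (fun ε : ℝ => a * f' (y + ε * a) - a * f' (y + ε * (-a)))
        (2 * (a ^ 2 * c)) 0 := by
      have hd : ∀ b : ℝ, HasDerivAt (fun ε : ℝ => f' (y + ε * b)) (c * b) 0 := fun b => by
        have h1 : HasDerivAt (fun ε : ℝ => y + ε * b) b 0 := by
          simpa using ((hasDerivAt_id (0 : ℝ)).mul_const b).const_add y
        have h2 : HasDerivAt f' c (y + 0 * b) := by simpa using hf'
        exact h2.comp 0 h1
      refine (((hd a).const_mul a).sub ((hd (-a)).const_mul a)).congr_deriv ?_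
      ring
    have h1 := hasDerivAt_iff_tendsto_slope.1 hk
    have h2 := h1.const_mul (1 / 2 : ℝ)
    convert h2 using 2 with ε
    · simp [slope_def_field]
      ring
    · ring

lemma nonneg_of_hasDerivAt_of_le_left {g : ℝ → ℝ} {g' s r : ℝ} (hg : HasDerivAt g g' s)
    (hr : r < s) (hle : ∀ t ∈ Set.Ioo r s, g t ≤ g s) : 0 ≤ g' := by
  have h1 := (hasDerivAt_iff_tendsto_slope.1 hg).mono_left
    (nhdsWithin_mono s (fun t (ht : t ∈ Set.Iio s) => (ne_of_lt ht)) : nhdsWithin s (Set.Iio s) ≤ _)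
  refine ge_of_tendsto h1 ?_
  filter_upwards [Ioo_mem_nhdsLT hr] with t ht
  rw [slope_def_field]
  exact div_nonneg_of_nonpos (by linarith [hle t ht]) (by linarith [ht.2])

/-! ### The maximum principle -/

/-- The log-volume of the ellipsoid of `A`, penalised by the barrier terms at lattice points. -/
def potential {n : ℕ} (F : Finset (Fin n → ℤ)) (a β δ s₀ : ℝ) (A : Matrix (Fin n) (Fin n) ℝ)
    (s : ℝ) : ℝ :=
  -(1 / 2) * Real.log A.det + a * (s - s₀)
    - β * ∑ x ∈ F, (barrier (intForm A x) s - barrier (intForm A x) s₀) - δ * A.trace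

lemma intForm_pos_of_mem {n : ℕ} {A : Matrix (Fin n) (Fin n) ℝ} (hA : A ∈ admissible n)
    {F : Finset (Fin n → ℤ)} (hF : 0 ∉ F) {x : Fin n → ℤ} (hx : x ∈ F) : 0 < intForm A x :=
  one_pos.trans_le (hA.2 x fun h => hF (h ▸ hx))

lemma hasDerivAt_potential {n : ℕ} {F : Finset (Fin n → ℤ)} (hF : 0 ∉ F) (a β δ s₀ : ℝ)
    {A : Matrix (Fin n) (Fin n) ℝ} (hA : A ∈ admissible n) {s : ℝ} (hs : 0 < s) :
    HasDerivAt (potential F a β δ s₀ A)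
      (a - β * ∑ x ∈ F, gaussCdf (hitThreshold (intForm A x) s)) s := by
  have h1 : HasDerivAt (fun t => ∑ x ∈ F, (barrier (intForm A x) t - barrier (intForm A x) s₀))
      (∑ x ∈ F, gaussCdf (hitThreshold (intForm A x) s)) s :=
    HasDerivAt.fun_sum fun x hx =>
      (hasDerivAt_barrier_right (intForm_pos_of_mem hA hF hx) hs).sub_const _
  have h2 : HasDerivAt (fun t => -(1 / 2) * Real.log A.det + a * (t - s₀)) a s := by
    simpa using (((hasDerivAt_id s).sub_const s₀).const_mul a).const_add
      (-(1 / 2) * Real.log A.det)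
  exact (h2.sub (h1.const_mul β)).sub_const (δ * A.trace)

lemma half_le_gaussCdf_hitThreshold_one {s : ℝ} (hs : 0 < s) :
    1 / 2 ≤ gaussCdf (hitThreshold 1 s) := by
  refine half_le_gaussCdf ?_
  rw [hitThreshold, Real.log_one]
  positivity

/-- The potential decreases, to second order, along the average of a pair of opposite
perturbations unless the barrier terms compensate the concavity of `log det`. -/
lemma sq_div_two_le_sum_second_difference {n : ℕ} {F : Finset (Fin n → ℤ)}
    {a β δ s₀ s ε : ℝ} {M S : Matrix (Fin n) (Fin n) ℝ} (hM : M.det ≠ 0)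
    (hsymm : S.IsSymm) (hS : ∑ i, ∑ j, S i j ^ 2 = 1) (hε : ε ^ 2 ≤ 1)
    (hp : M.transpose * (1 + ε • S) * M ∈ admissible n)
    (hm : M.transpose * (1 + (-ε) • S) * M ∈ admissible n)
    (hmax : ∀ B ∈ admissible n,
      potential F a β δ s₀ B s ≤ potential F a β δ s₀ (M.transpose * M) s) :
    ε ^ 2 / 2 ≤ β * ∑ x ∈ F,
      ((barrier (intForm (M.transpose * M) x
            + ε * (M.mulVec (intVec x) ⬝ᵥ S.mulVec (M.mulVec (intVec x)))) s
          - barrier (intForm (M.transpose * M) x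
            + ε * (M.mulVec (intVec x) ⬝ᵥ S.mulVec (M.mulVec (intVec x)))) s₀)
        + (barrier (intForm (M.transpose * M) x
            + -ε * (M.mulVec (intVec x) ⬝ᵥ S.mulVec (M.mulVec (intVec x)))) s
          - barrier (intForm (M.transpose * M) x
            + -ε * (M.mulVec (intVec x) ⬝ᵥ S.mulVec (M.mulVec (intVec x)))) s₀)
        - 2 * (barrier (intForm (M.transpose * M) x) s
          - barrier (intForm (M.transpose * M) x) s₀)) := by
  have hform : ∀ (η : ℝ) (x : Fin n → ℤ), intForm (M.transpose * (1 + η • S) * M) x =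
      intForm (M.transpose * M) x
        + η * (M.mulVec (intVec x) ⬝ᵥ S.mulVec (M.mulVec (intVec x))) := fun η x =>
    dotProduct_perturb_mulVec M S η (intVec x)
  have htr : (M.transpose * (1 + ε • S) * M).trace + (M.transpose * (1 + (-ε) • S) * M).trace =
      2 * (M.transpose * M).trace := by
    rw [← Matrix.trace_add, ← add_mul, ← mul_add, add_add_add_comm, ← add_smul, add_neg_cancel,
      zero_smul, add_zero, mul_add, mul_one, add_mul, Matrix.trace_add, two_mul]
  have hlog := log_det_perturb_add_le hM hsymm hS hε hp.1.det_pos hm.1.det_pos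
  have h1 := hmax _ hp
  have h2 := hmax _ hm
  simp only [potential, hform] at h1 h2
  rw [Finset.sum_sub_distrib, Finset.sum_add_distrib, ← Finset.mul_sum]
  have htr' : δ * (M.transpose * (1 + ε • S) * M).trace
      + δ * (M.transpose * (1 + (-ε) • S) * M).trace = 2 * (δ * (M.transpose * M).trace) := by
    rw [← (mul_add δ _ _), htr]
    ring
  linarith

lemma false_of_potential_le {n : ℕ} (hn : 2 ≤ n) {F : Finset (Fin n → ℤ)} (hF : 0 ∉ F)
    {a δ s₀ s : ℝ} (hs₀ : 0 < s₀) (hs : s₀ < s) (ha : a < (n : ℝ) * (n + 2) / 8)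
    {A : Matrix (Fin n) (Fin n) ℝ} (hA : A ∈ admissible n)
    (hcF : ∀ x : Fin n → ℤ, x ≠ 0 → intForm A x = 1 → x ∈ F)
    (htime : ∀ t ∈ Set.Ioo s₀ s,
      potential F a (n / (2 * (n - 1))) δ s₀ A t ≤ potential F a (n / (2 * (n - 1))) δ s₀ A s)
    (hmax : ∀ B ∈ admissible n,
      potential F a (n / (2 * (n - 1))) δ s₀ B s ≤ potential F a (n / (2 * (n - 1))) δ s₀ A s) :
    False := by
  have hn2 : (2 : ℝ) ≤ n := by exact_mod_cast hn
  have hspos : 0 < s := hs₀.trans hs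
  set β : ℝ := n / (2 * (n - 1)) with hβ
  have hβ0 : 0 < β := by
    rw [hβ]
    exact div_pos (by linarith) (by linarith)
  have hβθ : β * (1 - 1 / (n : ℝ)) = 1 / 2 := by
    have : (n : ℝ) - 1 ≠ 0 := by linarith
    rw [hβ]
    field_simp
  have hθ : 0 ≤ 1 - 1 / (n : ℝ) := by
    by_contra h
    nlinarith
  have h1 := nonneg_of_hasDerivAt_of_le_left (hasDerivAt_potential hF a β δ s₀ hA hspos) hs htime
  obtain ⟨M, hAM, hM⟩ := exists_transpose_mul_self_of_posDef hA.1
  obtain ⟨m, S, hm, hsymm, hS, hzero, hbessel⟩ := exists_orthonormal_symm (n := n) (by omega)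
    (κ := {x // x ∈ F.filter fun x => intForm A x = 1}) fun x => M.mulVec (intVec x.1)
  rw [Fintype.card_coe] at hm
  set q : Fin m → (Fin n → ℤ) → ℝ := fun i x =>
    M.mulVec (intVec x) ⬝ᵥ (S i).mulVec (M.mulVec (intVec x)) with hq
  have hqc : ∀ i, ∀ x ∈ F, intForm A x = 1 → q i x = 0 := fun i x hx hx1 =>
    hzero i ⟨x, Finset.mem_filter.2 ⟨hx, hx1⟩⟩
  have hyform : ∀ x, M.mulVec (intVec x) ⬝ᵥ M.mulVec (intVec x) = intForm A x := fun x => by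
    rw [hAM, intForm, dotProduct_transpose_mul_mulVec]
  have hev : ∀ᶠ ε : ℝ in nhds 0, ∀ i, M.transpose * (1 + ε • S i) * M ∈ admissible n := by
    rw [Filter.eventually_all]
    exact fun i => eventually_perturb_mem_admissible (hAM ▸ hA) (hsymm i) (hS i)
      fun x hx hx1 => hqc i x (hcF x hx (hAM ▸ hx1)) (hAM ▸ hx1)
  have hev' : ∀ᶠ ε : ℝ in nhds 0, ∀ i, M.transpose * (1 + (-ε) • S i) * M ∈ admissible n := by
    have : Filter.Tendsto (fun ε : ℝ => -ε) (nhds 0) (nhds 0) := by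
      simpa using (continuous_neg (G := ℝ)).tendsto 0
    exact this.eventually hev
  have hsmall : ∀ᶠ ε : ℝ in nhds 0, ε ^ 2 < 1 := by
    have : Continuous fun ε : ℝ => ε ^ 2 := by fun_prop
    exact this.continuousAt.eventually (gt_mem_nhds (by norm_num))
  set f : ℝ → ℝ := fun y => barrier y s - barrier y s₀ with hf
  set c : ℝ → ℝ := fun y => 2 * gaussCdf (hitThreshold y s) / y ^ 2
    - 2 * gaussCdf (hitThreshold y s₀) / y ^ 2 with hc
  have hlim : Filter.Tendsto (fun ε : ℝ => β * ∑ i, ∑ x ∈ F,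
      (f (intForm A x + ε * q i x) + f (intForm A x + -ε * q i x) - 2 * f (intForm A x)) / ε ^ 2)
      (nhdsWithin 0 {0}ᶜ) (nhds (β * ∑ i, ∑ x ∈ F, q i x ^ 2 * c (intForm A x))) := by
    refine Filter.Tendsto.const_mul β (tendsto_finsetSum _ fun i _ =>
      tendsto_finsetSum _ fun x hx => ?_)
    have hy := intForm_pos_of_mem hA hF hx
    refine tendsto_second_difference (f' := fun y =>
      2 * (-(gaussCdf (hitThreshold y s) / y) + gaussCdf (hitThreshold y s - √s))
      - 2 * (-(gaussCdf (hitThreshold y s₀) / y) + gaussCdf (hitThreshold y s₀ - √s₀))) ?_ ?_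
    · filter_upwards [lt_mem_nhds hy] with z hz
      exact (hasDerivAt_barrier_left hz hspos).sub (hasDerivAt_barrier_left hz hs₀)
    · exact (hasDerivAt_barrier_left_deriv hy hspos).sub (hasDerivAt_barrier_left_deriv hy hs₀)
  have hmle : (m : ℝ) / 2 ≤ β * ∑ i, ∑ x ∈ F, q i x ^ 2 * c (intForm A x) := by
    refine ge_of_tendsto hlim ?_
    filter_upwards [self_mem_nhdsWithin, hev.filter_mono nhdsWithin_le_nhds,
      hev'.filter_mono nhdsWithin_le_nhds, hsmall.filter_mono nhdsWithin_le_nhds]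
      with ε hε0 hε1 hε2 hε3
    have hε : 0 < ε ^ 2 := by
      have : ε ≠ 0 := hε0
      positivity
    have hi : ∀ i, 1 / 2 ≤ β * ∑ x ∈ F,
        (f (intForm A x + ε * q i x) + f (intForm A x + -ε * q i x) - 2 * f (intForm A x))
          / ε ^ 2 := by
      intro i
      have := sq_div_two_le_sum_second_difference hM (hsymm i) (hS i) hε3.le (hε1 i) (hε2 i)
        (fun B hB => hAM ▸ hmax B hB)
      rw [← hAM] at this
      rw [← Finset.sum_div, ← mul_div_assoc, le_div_iff₀ hε]
      linarith
    calc (m : ℝ) / 2 = ∑ _i : Fin m, (1 / 2 : ℝ) := by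
          simp
          ring
      _ ≤ _ := Finset.sum_le_sum fun i _ => hi i
      _ = _ := by rw [Finset.mul_sum]
  have hterm : ∀ x ∈ F, β * ∑ i, q i x ^ 2 * c (intForm A x) ≤
      if intForm A x = 1 then 0 else gaussCdf (hitThreshold (intForm A x) s) := by
    intro x hx
    split_ifs with hx1
    · simp [hqc _ x hx hx1]
    · have hy := intForm_pos_of_mem hA hF hx
      have h2 := hbessel (M.mulVec (intVec x))
      rw [hyform] at h2
      have h3 : c (intForm A x) ≤ 2 * gaussCdf (hitThreshold (intForm A x) s)
          / intForm A x ^ 2 := by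
        have : 0 ≤ 2 * gaussCdf (hitThreshold (intForm A x) s₀) / intForm A x ^ 2 := by
          have := gaussCdf_nonneg (hitThreshold (intForm A x) s₀)
          positivity
        simp only [hc]
        linarith
      have h0 := gaussCdf_nonneg (hitThreshold (intForm A x) s)
      rw [← Finset.sum_mul]
      calc β * ((∑ i, q i x ^ 2) * c (intForm A x))
          ≤ β * ((∑ i, q i x ^ 2) * (2 * gaussCdf (hitThreshold (intForm A x) s)
            / intForm A x ^ 2)) := by gcongr
        _ ≤ β * (((1 - 1 / (n : ℝ)) * intForm A x ^ 2) *
            (2 * gaussCdf (hitThreshold (intForm A x) s) / intForm A x ^ 2)) := by gcongr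
        _ = β * (1 - 1 / (n : ℝ)) * 2 * gaussCdf (hitThreshold (intForm A x) s) := by
            field_simp
        _ = _ := by
            rw [hβθ]
            ring
  have hcard : ((F.filter fun x => intForm A x = 1).card : ℝ) / 2 ≤
      ∑ x ∈ F, if intForm A x = 1 then gaussCdf (hitThreshold (intForm A x) s) else 0 := by
    rw [← Finset.sum_filter, div_eq_mul_one_div, ← nsmul_eq_mul]
    refine Finset.card_nsmul_le_sum _ _ _ fun x hx => ?_
    rw [(Finset.mem_filter.1 hx).2]
    exact half_le_gaussCdf_hitThreshold_one hspos
  have hsum : (m : ℝ) / 2 + ((F.filter fun x => intForm A x = 1).card : ℝ) / 2 ≤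
      ∑ x ∈ F, gaussCdf (hitThreshold (intForm A x) s) := by
    rw [Finset.sum_comm, Finset.mul_sum] at hmle
    refine (add_le_add (hmle.trans (Finset.sum_le_sum hterm)) hcard).trans (le_of_eq ?_)
    rw [← Finset.sum_add_distrib]
    refine Finset.sum_congr rfl fun x _ => ?_
    split_ifs <;> simp
  have h4 : β * (((n : ℝ) - 1) * (n + 2) / 4) ≤ a := by
    have : ((n : ℝ) - 1) * (n + 2) / 4 ≤ ∑ x ∈ F, gaussCdf (hitThreshold (intForm A x) s) := by
      linarith
    linarith [mul_le_mul_of_nonneg_left this hβ0.le]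
  have h5 : β * (((n : ℝ) - 1) * (n + 2) / 4) = (n : ℝ) * (n + 2) / 8 := by
    have : (n : ℝ) - 1 ≠ 0 := by linarith
    rw [hβ]
    field_simp
    ring
  linarith

lemma barrier_le_barrier {y s t : ℝ} (hy : 0 < y) (hs : 0 < s) (hst : s ≤ t) :
    barrier y s ≤ barrier y t := by
  have hmono : MonotoneOn (fun r => barrier y r) (Set.Ici s) := by
    refine monotoneOn_of_deriv_nonneg (convex_Ici s) (fun r hr => ?_) (fun r hr => ?_)
      fun r hr => ?_
    · exact (hasDerivAt_barrier_right hy (hs.trans_le hr)).continuousAt.continuousWithinAt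
    · rw [interior_Ici] at hr
      exact (hasDerivAt_barrier_right hy (hs.trans hr)).differentiableAt.differentiableWithinAt
    · rw [interior_Ici] at hr
      rw [(hasDerivAt_barrier_right hy (hs.trans hr)).deriv]
      exact gaussCdf_nonneg _
  exact hmono (Set.self_mem_Ici) hst hst

lemma abs_apply_le_trace {n : ℕ} {A : Matrix (Fin n) (Fin n) ℝ} (hA : A.PosSemidef)
    (i j : Fin n) : |A i j| ≤ A.trace := by
  have hsymm : A j i = A i j := by simpa using hA.1.apply i j
  have hle : ∀ k, A k k ≤ A.trace := fun k =>
    Finset.single_le_sum (f := fun k => A k k) (fun k _ => hA.diag_nonneg) (Finset.mem_univ k)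
  have key : ∀ σ : ℝ, σ * σ = 1 → 0 ≤ A i i + A j j + 2 * σ * A i j := by
    intro σ hσ
    have h := hA.dotProduct_mulVec_nonneg (Pi.single i 1 + σ • Pi.single j 1)
    have e : star (Pi.single i 1 + σ • Pi.single j 1 : Fin n → ℝ) ⬝ᵥ
        A.mulVec (Pi.single i 1 + σ • Pi.single j 1) =
        A i i + σ * A i j + (σ * A j i + σ * σ * A j j) := by
      simp only [star_trivial, Matrix.mulVec_add, Matrix.mulVec_smul, add_dotProduct,
        dotProduct_add, smul_dotProduct, dotProduct_smul, Matrix.mulVec_single_one,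
        single_one_dotProduct, Matrix.col_apply, smul_eq_mul]
      ring
    rw [e, hsymm, hσ] at h
    linarith
  have h1 := key 1 (by norm_num)
  have h2 := key (-1) (by norm_num)
  rw [abs_le]
  constructor <;> linarith [hle i, hle j]

/-- Positive semidefinite matrices of bounded trace and determinant bounded below whose open
ellipsoid contains no nonzero lattice point. -/
def admissibleBounded (n : ℕ) (R d : ℝ) : Set (Matrix (Fin n) (Fin n) ℝ) :=
  {A | A.PosSemidef ∧ A.trace ≤ R ∧ d ≤ A.det ∧ ∀ x : Fin n → ℤ, x ≠ 0 → 1 ≤ intForm A x}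

lemma continuous_intForm {n : ℕ} (x : Fin n → ℤ) :
    Continuous fun A : Matrix (Fin n) (Fin n) ℝ => intForm A x := by
  unfold intForm
  fun_prop

lemma isCompact_admissibleBounded (n : ℕ) (R d : ℝ) : IsCompact (admissibleBounded n R d) := by
  have hbox : IsCompact (Set.univ.pi fun _ : Fin n => Set.univ.pi fun _ : Fin n =>
      Set.Icc (-R) R) :=
    isCompact_univ_pi fun _ => isCompact_univ_pi fun _ => isCompact_Icc
  have hclosed : IsClosed (admissibleBounded n R d) := by
    have e : admissibleBounded n R d = {A | A.transpose = A} ∩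
        {A | ∀ v : Fin n → ℝ, 0 ≤ v ⬝ᵥ A.mulVec v} ∩ {A | A.trace ≤ R} ∩ {A | d ≤ A.det} ∩
        {A | ∀ x : Fin n → ℤ, x ≠ 0 → 1 ≤ intForm A x} := by
      ext A
      simp only [admissibleBounded, Matrix.posSemidef_iff_dotProduct_mulVec, Matrix.IsHermitian,
        Matrix.conjTranspose_eq_transpose_of_trivial, star_trivial, Set.mem_inter_iff,
        Set.mem_ofPred_eq]
      tauto
    rw [e]
    refine (((IsClosed.inter ?_ ?_).inter ?_).inter ?_).inter ?_
    · exact isClosed_eq (by fun_prop) (by fun_prop)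
    · simp only [Set.ofPred_forall]
      exact isClosed_iInter fun v => isClosed_le (by fun_prop) (by fun_prop)
    · exact isClosed_le (by fun_prop) (by fun_prop)
    · exact isClosed_le (by fun_prop) (by fun_prop)
    · simp only [Set.ofPred_forall]
      exact isClosed_iInter fun x => isClosed_iInter fun _ =>
        isClosed_le continuous_const (continuous_intForm x)
  refine hbox.of_isClosed_subset hclosed fun A hA i _ j _ => ?_
  exact abs_le.1 ((abs_apply_le_trace hA.1 i j).trans hA.2.1)

lemma admissibleBounded_subset {n : ℕ} {R d : ℝ} (hd : 0 < d) :
    admissibleBounded n R d ⊆ admissible n := fun _ hA =>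
  ⟨hA.1.posDef_iff_det_ne_zero.2 (hd.trans_le hA.2.2.1).ne', hA.2.2.2⟩

lemma tendsto_barrier {α : Type*} {l : Filter α} {u v : α → ℝ} {y s : ℝ} (hy : 0 < y)
    (hs : 0 < s) (hu : Filter.Tendsto u l (nhds y)) (hv : Filter.Tendsto v l (nhds s)) :
    Filter.Tendsto (fun p => barrier (u p) (v p)) l (nhds (barrier y s)) := by
  have h := (continuousAt_barrier hy hs).tendsto.comp (hu.prodMk_nhds hv)
  simpa only [Function.comp_def] using h

lemma continuousOn_potential {n : ℕ} {F : Finset (Fin n → ℤ)} (hF : 0 ∉ F)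
    {a β δ s₀ T : ℝ} (hs₀ : 0 < s₀) :
    ContinuousOn (fun p : Matrix (Fin n) (Fin n) ℝ × ℝ => potential F a β δ s₀ p.1 p.2)
      (admissible n ×ˢ Set.Icc s₀ T) := by
  rintro ⟨A, s⟩ ⟨hA, hs⟩
  refine ContinuousAt.continuousWithinAt ?_
  have hb : ∀ x ∈ F, ∀ g : Matrix (Fin n) (Fin n) ℝ × ℝ → ℝ, ∀ t, 0 < t →
      Filter.Tendsto g (nhds (A, s)) (nhds t) →
      Filter.Tendsto (fun p : Matrix (Fin n) (Fin n) ℝ × ℝ => barrier (intForm p.1 x) (g p))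
        (nhds (A, s)) (nhds (barrier (intForm A x) t)) := by
    intro x hx g t ht hg
    have h0 : Filter.Tendsto (fun p : Matrix (Fin n) (Fin n) ℝ × ℝ => intForm p.1 x)
        (nhds (A, s)) (nhds (intForm A x)) :=
      ((continuous_intForm x).comp continuous_fst).tendsto (A, s)
    exact tendsto_barrier (intForm_pos_of_mem hA hF hx) ht h0 hg
  unfold potential
  refine ((ContinuousAt.add ?_ ?_).sub (continuousAt_const.mul ?_)).sub ?_
  · refine continuousAt_const.mul (ContinuousAt.log ?_ hA.1.det_pos.ne')
    exact (continuous_fst.matrix_det).continuousAt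
  · fun_prop
  · refine tendsto_finsetSum _ fun x hx => Filter.Tendsto.sub ?_ ?_
    · exact hb x hx Prod.snd s (hs₀.trans_le hs.1) continuousAt_snd
    · exact hb x hx (fun _ => s₀) s₀ hs₀ tendsto_const_nhds
  · exact (continuous_const.mul continuous_fst.matrix_trace).continuousAt

/-- Maximum principle: a bound `V` for the log-volume of all admissible ellipsoids bounds the
potential of any admissible starting form. -/
lemma neg_log_det_add_le_of_forall_le {n : ℕ} (hn : 2 ≤ n) {V : ℝ}
    (hV : ∀ A ∈ admissible n, -(1 / 2) * Real.log A.det ≤ V) {s₀ T a b : ℝ} (hs₀ : 0 < s₀)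
    (hT : s₀ ≤ T) (ha : a < (n : ℝ) * (n + 2) / 8) {A₀ : Matrix (Fin n) (Fin n) ℝ}
    (hA₀ : A₀ ∈ admissible n)
    (hb : ∀ F : Finset (Fin n → ℤ), 0 ∉ F →
      ∑ x ∈ F, (barrier (intForm A₀ x) T - barrier (intForm A₀ x) s₀) ≤ b) :
    -(1 / 2) * Real.log A₀.det + a * (T - s₀) - n / (2 * (n - 1)) * b ≤ V := by
  by_contra! hlt
  have hn2 : (2 : ℝ) ≤ n := by exact_mod_cast hn
  set β : ℝ := n / (2 * (n - 1)) with hβ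
  have hβ0 : 0 < β := by
    rw [hβ]
    exact div_pos (by linarith) (by linarith)
  set L₀ := -(1 / 2) * Real.log A₀.det + a * (T - s₀) - β * b with hL₀
  have htr0 := hA₀.1.posSemidef.trace_nonneg
  obtain ⟨δ, hδ, hδL⟩ : ∃ δ : ℝ, 0 < δ ∧ V < L₀ - δ * A₀.trace := by
    refine ⟨(L₀ - V) / (2 * (A₀.trace + 1)), div_pos (by linarith) (by linarith), ?_⟩
    have : (L₀ - V) / (2 * (A₀.trace + 1)) * A₀.trace ≤ (L₀ - V) / 2 := by
      rw [div_mul_eq_mul_div, div_le_div_iff₀ (by linarith) two_pos]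
      nlinarith
    linarith
  set L := L₀ - δ * A₀.trace with hL
  have hlow : ∀ F : Finset (Fin n → ℤ), 0 ∉ F → L ≤ potential F a β δ s₀ A₀ T := by
    intro F hF
    have := mul_le_mul_of_nonneg_left (hb F hF) hβ0.le
    rw [potential]
    linarith
  have hup : ∀ F : Finset (Fin n → ℤ), 0 ∉ F → ∀ A ∈ admissible n, ∀ s ∈ Set.Icc s₀ T,
      potential F a β δ s₀ A s ≤ V + |a| * (T - s₀) - δ * A.trace := by
    intro F hF A hA s hs
    have h1 : 0 ≤ ∑ x ∈ F, (barrier (intForm A x) s - barrier (intForm A x) s₀) :=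
      Finset.sum_nonneg fun x hx =>
        sub_nonneg.2 (barrier_le_barrier (intForm_pos_of_mem hA hF hx) hs₀ hs.1)
    have h2 : a * (s - s₀) ≤ |a| * (T - s₀) :=
      mul_le_mul (le_abs_self a) (by linarith [hs.2]) (by linarith [hs.1]) (abs_nonneg a)
    have h3 := mul_nonneg hβ0.le h1
    rw [potential]
    linarith [hV A hA]
  set R := (V + |a| * (T - s₀) - L) / δ with hR
  have hbig : ∀ F : Finset (Fin n → ℤ), 0 ∉ F → ∀ A ∈ admissible n, ∀ s ∈ Set.Icc s₀ T,
      L ≤ potential F a β δ s₀ A s → A.trace ≤ R := by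
    intro F hF A hA s hs h
    rw [hR, le_div_iff₀ hδ]
    linarith [hup F hF A hA s hs]
  set C := admissibleBounded n R (Real.exp (-2 * V)) with hC
  have hsub : C ⊆ admissible n := admissibleBounded_subset (Real.exp_pos _)
  have hmem : ∀ A ∈ admissible n, A.trace ≤ R → A ∈ C := by
    refine fun A hA htr => ⟨hA.1.posSemidef, htr, ?_, hA.2⟩
    rw [← Real.le_log_iff_exp_le hA.1.det_pos]
    linarith [hV A hA]
  have hCc : IsCompact C := isCompact_admissibleBounded n R _
  have hfin := finite_intForm_le_of_isCompact hCc (fun A hA => (hsub hA).1) 1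
  set F := hfin.toFinset.erase 0 with hFdef
  have hF : (0 : Fin n → ℤ) ∉ F := Finset.notMem_erase _ _
  have hTmem : T ∈ Set.Icc s₀ T := ⟨hT, le_rfl⟩
  have hA₀C : A₀ ∈ C := hmem A₀ hA₀ (hbig F hF A₀ hA₀ T hTmem (hlow F hF))
  obtain ⟨⟨A, s⟩, ⟨hAC, hs⟩, hmax⟩ := (hCc.prod (isCompact_Icc (a := s₀) (b := T))).exists_isMaxOn
    ⟨(A₀, T), hA₀C, hTmem⟩
    ((continuousOn_potential (a := a) (β := β) (δ := δ) hF hs₀).mono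
      (Set.prod_mono hsub subset_rfl))
  have hA := hsub hAC
  have hmax' : ∀ B ∈ C, ∀ t ∈ Set.Icc s₀ T,
      potential F a β δ s₀ B t ≤ potential F a β δ s₀ A s := fun B hB t ht =>
    hmax (show (B, t) ∈ C ×ˢ Set.Icc s₀ T from ⟨hB, ht⟩)
  have hLA : L ≤ potential F a β δ s₀ A s := (hlow F hF).trans (hmax' A₀ hA₀C T hTmem)
  have hss : s₀ < s := by
    refine lt_of_le_of_ne hs.1 fun h => ?_
    rw [← h, potential] at hLA
    simp only [sub_self, mul_zero, Finset.sum_const_zero, add_zero, sub_zero] at hLA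
    linarith [hV A hA, mul_nonneg hδ.le hA.1.posSemidef.trace_nonneg]
  refine false_of_potential_le (δ := δ) hn hF hs₀ hss ha hA (fun x hx hx1 => ?_)
    (fun t ht => hmax' A hAC t ⟨ht.1.le, ht.2.le.trans hs.2⟩) fun B hB => ?_
  · rw [hFdef, Finset.mem_erase, Set.Finite.mem_toFinset]
    exact ⟨hx, A, hAC, hx1.le⟩
  · by_contra! h
    have := hmem B hB (hbig F hF B hB s hs (hLA.trans h.le))
    exact absurd (hmax' B this s hs) (not_le.2 h)

/-! ### Choice of parameters -/

lemma intForm_smul_one {n : ℕ} (r : ℝ) (x : Fin n → ℤ) :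
    intForm (r • (1 : Matrix (Fin n) (Fin n) ℝ)) x = r * intNormSq x := by
  rw [intForm, Matrix.smul_mulVec, Matrix.one_mulVec, dotProduct_smul, intVec_dotProduct_self,
    smul_eq_mul]

lemma exp_smul_one_mem_admissible (n : ℕ) {l : ℝ} (hl : 0 ≤ l) :
    Real.exp l • (1 : Matrix (Fin n) (Fin n) ℝ) ∈ admissible n := by
  refine ⟨Matrix.PosDef.one.smul (Real.exp_pos l), fun x hx => ?_⟩
  rw [intForm_smul_one]
  exact one_le_mul_of_one_le_of_one_le (Real.one_le_exp hl) (one_le_intNormSq hx)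

lemma neg_half_log_det_exp_smul_one (n : ℕ) (l : ℝ) :
    -(1 / 2) * Real.log (Real.exp l • (1 : Matrix (Fin n) (Fin n) ℝ)).det = -(n * l / 2) := by
  rw [Matrix.det_smul, Matrix.det_one, mul_one, Fintype.card_fin, Real.log_pow, Real.log_exp]
  ring

lemma exists_mem_admissible_lt {n : ℕ} (hn : 2 ≤ n) :
    ∃ A ∈ admissible n, Real.log ((n : ℝ) * (n + 2) / 8) - Real.log (ballVol n) - 6 <
      -(1 / 2) * Real.log A.det := by
  by_contra! hV
  have hn2 : (2 : ℝ) ≤ n := by exact_mod_cast hn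
  have hn0 : n ≠ 0 := by omega
  have hvol := ballVol_pos n
  obtain ⟨M, hM0, hM⟩ := exists_card_filter_le hn0
  set α : ℝ := (n : ℝ) * (n + 2) / 8 with hα
  have hα0 : 0 < α := by positivity
  set c : ℝ := 2 / n * (Real.log (ballVol n) - Real.log α) with hc
  have hev : ∀ᶠ T : ℝ in Filter.atTop, M * (8 / 3) * Real.exp (-(c / 2) - 1 / 8 * T) < 1 := by
    have h1 : Filter.Tendsto (fun T : ℝ => M * (8 / 3) * Real.exp (-(c / 2) - 1 / 8 * T))
        Filter.atTop (nhds (M * (8 / 3) * 0)) := by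
      refine Filter.Tendsto.const_mul _ (Real.tendsto_exp_atBot.comp ?_)
      refine Filter.tendsto_atBot_add_const_left _ _ ?_
      exact Filter.tendsto_neg_atTop_atBot.comp (Filter.tendsto_id.const_mul_atTop (by norm_num))
    exact h1.eventually (gt_mem_nhds (by norm_num))
  obtain ⟨T, hT1, hTs, hTc⟩ := (hev.and ((Filter.eventually_ge_atTop (1 / α)).and
    (Filter.eventually_ge_atTop |c|))).exists
  have hTpos : 0 < T := (by positivity : 0 < 1 / α).trans_le hTs
  set l : ℝ := c + (n + 2) / 4 * T with hl
  have hl0 : 0 ≤ l := by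
    have := neg_abs_le c
    rw [hl]
    nlinarith
  have hnl : n * l / 2 = Real.log (ballVol n) - Real.log α + α * T := by
    rw [hl, hc, hα]
    field_simp
    ring
  have hb : ∀ F : Finset (Fin n → ℤ), 0 ∉ F →
      ∑ x ∈ F, (barrier (intForm (Real.exp l • (1 : Matrix (Fin n) (Fin n) ℝ)) x) T
        - barrier (intForm (Real.exp l • (1 : Matrix (Fin n) (Fin n) ℝ)) x) (1 / α)) ≤ 3 := by
    intro F hF
    simp only [intForm_smul_one]
    have h1 := sum_barrier_sub_le hn0 hM0 hF (hM F hF) l (by positivity : 0 < 1 / α) hTs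
    have h2 : 2 * ballVol n / α * Real.exp (-(n * l / 2) + α * T) = 2 := by
      rw [hnl, show -(Real.log (ballVol n) - Real.log α + α * T) + α * T =
        Real.log α - Real.log (ballVol n) by ring, Real.exp_sub, Real.exp_log hα0,
        Real.exp_log hvol]
      field_simp
    have h3 : M * (8 / 3) * Real.exp (-(l / 2) + 3 / 8 * T) ≤
        M * (8 / 3) * Real.exp (-(c / 2) - 1 / 8 * T) := by
      refine mul_le_mul_of_nonneg_left (Real.exp_le_exp.2 ?_) (by positivity)
      rw [hl]
      nlinarith
    rw [← hα, h2] at h1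
    linarith
  have hβ : (n : ℝ) / (2 * (n - 1)) ≤ 1 := by
    rw [div_le_one (by linarith)]
    linarith
  have h := neg_log_det_add_le_of_forall_le hn hV (a := α - 1 / T) (by positivity : 0 < 1 / α)
    hTs (by linarith [(by positivity : 0 < 1 / T)]) (exp_smul_one_mem_admissible n hl0) hb
  rw [neg_half_log_det_exp_smul_one, hnl] at h
  have h4 : (α - 1 / T) * (T - 1 / α) = α * T - 2 + 1 / (T * α) := by
    field_simp
    ring
  have h5 : 0 < 1 / (T * α) := by positivity
  linarith

/-- If `|M v| ≥ 1` for every nonzero lattice point `v` and the ellipsoid `{v | |M v| < 1}` has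
volume at least `w`, then some homothetic ellipsoid has volume exactly `w` and is free of nonzero
lattice points. -/
lemma exists_linearEquiv_of_mem_admissible {n : ℕ} (hn : n ≠ 0)
    {M : Matrix (Fin n) (Fin n) ℝ} (hM : M.det ≠ 0) (hA : M.transpose * M ∈ admissible n) {w : ℝ}
    (hw : 0 < w) (hle : w ≤ ballVol n / |M.det|) :
    ∃ T : Euc n ≃ₗ[ℝ] Euc n,
      volume (T '' Metric.ball (0 : Euc n) 1) = ENNReal.ofReal w ∧
      (T '' Metric.ball (0 : Euc n) 1) ∩ intPoints n ⊆ {0} := by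
  have hvol := ballVol_pos n
  have hdet : 0 < |M.det| := abs_pos.2 hM
  obtain ⟨r, hr0, hr1, hrn⟩ : ∃ r : ℝ, 0 < r ∧ r ≤ 1 ∧ r ^ n = w * |M.det| / ballVol n := by
    have hq : 0 < w * |M.det| / ballVol n := by positivity
    refine ⟨(w * |M.det| / ballVol n) ^ (1 / (n : ℝ)), by positivity, ?_, ?_⟩
    · refine Real.rpow_le_one hq.le ?_ (by positivity)
      rw [div_le_one hvol]
      rwa [le_div_iff₀ hdet] at hle
    · rw [← Real.rpow_natCast, ← Real.rpow_mul hq.le, one_div_mul_cancel (by positivity),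
        Real.rpow_one]
  have hN : (LinearMap.det (Matrix.toEuclideanLin (r • M⁻¹))) = r ^ n * (M.det)⁻¹ := by
    rw [Matrix.toEuclideanLin_eq_toLin_orthonormal, LinearMap.det_toLin, Matrix.det_smul,
      Matrix.det_nonsing_inv, Fintype.card_fin, Ring.inverse_eq_inv']
  have hN0 : LinearMap.det (Matrix.toEuclideanLin (r • M⁻¹)) ≠ 0 := by
    rw [hN]
    positivity
  have hcoe : ⇑((Matrix.toEuclideanLin (r • M⁻¹)).equivOfDetNeZero hN0) =
      Matrix.toEuclideanLin (r • M⁻¹) := rfl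
  refine ⟨(Matrix.toEuclideanLin (r • M⁻¹)).equivOfDetNeZero hN0, ?_, ?_⟩
  · have hb : volume (Metric.ball (0 : Euc n) 1) = ENNReal.ofReal (ballVol n) := by
      rw [ballVol, ofReal_measureReal measure_ball_lt_top.ne]
    rw [hcoe, Measure.addHaar_image_linearMap, hN, hb, ← ENNReal.ofReal_mul (abs_nonneg _), hrn,
      abs_mul, abs_inv, abs_of_pos (by positivity)]
    congr 1
    field_simp
  · rintro _ ⟨⟨v, hv, rfl⟩, h_lat⟩
    rw [hcoe] at h_lat ⊢
    choose x hx using h_lat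
    by_contra hne
    have hxv : intVec x = (r • M⁻¹).mulVec (WithLp.ofLp v) := by
      rw [← Matrix.toLin'_apply, ← Matrix.ofLp_toLpLin 2 2]
      exact funext fun i => (hx i).symm
    have hx0 : x ≠ 0 := by
      rintro rfl
      refine hne ?_
      ext i
      rw [hx i]
      simp
    have h1 := hA.2 x hx0
    rw [intForm, dotProduct_transpose_mul_mulVec, hxv, Matrix.smul_mulVec, Matrix.mulVec_smul,
      Matrix.mulVec_mulVec, Matrix.mul_nonsing_inv _ (isUnit_iff_ne_zero.2 hM),
      Matrix.one_mulVec, smul_dotProduct, dotProduct_smul, smul_eq_mul, smul_eq_mul] at h1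
    have h2 : WithLp.ofLp v ⬝ᵥ WithLp.ofLp v = ‖v‖ ^ 2 := by
      rw [EuclideanSpace.real_norm_sq_eq]
      simp [dotProduct, sq]
    have h3 : ‖v‖ < 1 := by simpa using hv
    rw [h2] at h1
    have h4 : ‖v‖ ^ 2 < 1 := by nlinarith [norm_nonneg v]
    have h5 : r * r ≤ 1 := by nlinarith
    nlinarith [sq_nonneg ‖v‖]

theorem exists_lattice_point_free_ellipsoid_of_volume_c_n_sq :
    ∃ c : ℝ, 0 < c ∧ ∀ n : ℕ, 2 ≤ n →
      ∃ T : Euc n ≃ₗ[ℝ] Euc n,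
        volume (T '' Metric.ball (0 : Euc n) 1) = ENNReal.ofReal (c * (n : ℝ) ^ 2) ∧
        (T '' Metric.ball (0 : Euc n) 1) ∩ intPoints n ⊆ {0} := by
  refine ⟨Real.exp (-6) / 8, by positivity, fun n hn => ?_⟩
  obtain ⟨A, hA, hlt⟩ := exists_mem_admissible_lt hn
  obtain ⟨M, rfl, hM⟩ := exists_transpose_mul_self_of_posDef hA.1
  have hn0 : n ≠ 0 := by omega
  have hn' : (0 : ℝ) < n := by positivity
  have hvol := ballVol_pos n
  have hdet : 0 < |M.det| := abs_pos.2 hM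
  refine exists_linearEquiv_of_mem_admissible hn0 hM hA (by positivity) ?_
  have h1 : Real.log (M.transpose * M).det = 2 * Real.log |M.det| := by
    rw [Matrix.det_mul, Matrix.det_transpose, Real.log_mul hM hM, Real.log_abs]
    ring
  rw [h1] at hlt
  have h2 : Real.log (Real.exp (-6) * ((n : ℝ) * (n + 2) / 8)) <
      Real.log (ballVol n / |M.det|) := by
    rw [Real.log_mul (Real.exp_ne_zero _) (by positivity), Real.log_exp,
      Real.log_div hvol.ne' hdet.ne']
    linarith
  refine le_trans ?_ ((Real.log_lt_log_iff (by positivity) (by positivity)).1 h2).le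
  have := Real.exp_pos (-6)
  nlinarith [mul_pos this hn']
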